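/- Let ℓ, m be positive integers and k = m/ℓ (a rational number). For any set A ⊆ ℕ with upper density d̄(A) > 1 − 1/(ℓ(k+1)(k+2)), there exists an infinite set B ⊆ ℕ such that {m·b₁ + ℓ·b₂ : b₁, b₂ ∈ B and b₁ ≤ b₂} ⊆ A. -/

import Mathlib

open Filter MeasureTheory Topology

open scoped Classical in
/-- Upper Banach density: `limsup` over window length `N` of the maximal count of
elements of `A` in a window of length `N`, divided by `N`. -/
noncomputable def upperBanachDensity (A : Set ℕ) : ℝ :=
  Filter.limsup
    (fun N : ℕ => ⨆ M : ℕ, (((Finset.Ico M (M + N)).filter (· ∈ A)).card : ℝ) / N)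
    Filter.atTop

open scoped Classical in
/-- Natural upper density of a set of naturals. -/
noncomputable def upperDensity (A : Set ℕ) : ℝ :=
  Filter.limsup (fun N : ℕ => (((Finset.Icc 1 N).filter (· ∈ A)).card : ℝ) / N)
    Filter.atTop

open scoped Classical in
/-- Natural lower density of a set of naturals. -/
noncomputable def lowerDensity (A : Set ℕ) : ℝ :=
  Filter.liminf (fun N : ℕ => (((Finset.Icc 1 N).filter (· ∈ A)).card : ℝ) / N)
    Filter.atTop

namespace SumsetAux

abbrev Om := Ultrafilter ℤ

instance instMSOm : MeasurableSpace Om := borel Om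
instance instBSOm : BorelSpace Om := ⟨rfl⟩

/-- limit of a function along an ultrafilter -/
noncomputable def ext (F : ℤ → ℝ) (p : Om) : ℝ := limUnder (p : Filter ℤ) F

def Bdd (F : ℤ → ℝ) : Prop := ∃ C, ∀ x, |F x| ≤ C

lemma ext_eq {F : ℤ → ℝ} {p : Om} {a : ℝ} (h : Tendsto F p (𝓝 a)) : ext F p = a :=
  h.limUnder_eq

lemma ext_tendsto {F : ℤ → ℝ} (hF : Bdd F) (p : Om) : Tendsto F p (𝓝 (ext F p)) := by
  obtain ⟨C, hC⟩ := hF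
  have hc : IsCompact (Set.Icc (-C) C) := isCompact_Icc
  obtain ⟨a, -, ha⟩ := hc.ultrafilter_le_nhds (p.map F) (by
    rw [le_principal_iff]
    exact Filter.mem_map.2 (Filter.univ_mem' fun x => abs_le.1 (hC x)))
  have : Tendsto F p (𝓝 a) := ha
  rwa [ext_eq this]

lemma ext_pure {F : ℤ → ℝ} (n : ℤ) : ext F (pure n) = F n :=
  ext_eq (by simpa using tendsto_pure_nhds F n)

lemma ext_continuous {F : ℤ → ℝ} (hF : Bdd F) : Continuous (ext F) := by
  rw [continuous_iff_continuousAt]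
  intro p
  rw [ContinuousAt, Metric.tendsto_nhds]
  intro ε hε
  have h1 := (Metric.tendsto_nhds.1 (ext_tendsto hF p)) (ε/2) (by positivity)
  have h2 : {x | dist (F x) (ext F p) < ε/2} ∈ p := h1
  have := (ultrafilter_isOpen_basic {x | dist (F x) (ext F p) < ε/2}).mem_nhds h2
  filter_upwards [this] with q hq
  have hq' : ∀ᶠ x in (q : Filter ℤ), dist (F x) (ext F p) ≤ ε/2 := by
    filter_upwards [show ∀ᶠ x in (q : Filter ℤ), dist (F x) (ext F p) < ε/2 from hq] with x hx using hx.le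
  have := le_of_tendsto ((ext_tendsto hF q).dist tendsto_const_nhds) hq'
  linarith

lemma ext_measurable {F : ℤ → ℝ} (hF : Bdd F) : Measurable (ext F) := (ext_continuous hF).measurable

lemma ext_le {F : ℤ → ℝ} (hF : Bdd F) {c : ℝ} {p : Om} (h : ∀ x, F x ≤ c) : ext F p ≤ c :=
  le_of_tendsto (ext_tendsto hF p) (Eventually.of_forall h)

lemma le_ext {F : ℤ → ℝ} (hF : Bdd F) {c : ℝ} {p : Om} (h : ∀ x, c ≤ F x) : c ≤ ext F p :=
  ge_of_tendsto (ext_tendsto hF p) (Eventually.of_forall h)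

lemma ext_mono {F G : ℤ → ℝ} (hF : Bdd F) (hG : Bdd G) {p : Om} (h : ∀ x, F x ≤ G x) :
    ext F p ≤ ext G p :=
  le_of_tendsto_of_tendsto' (ext_tendsto hF p) (ext_tendsto hG p) h

lemma ext_abs_le {F : ℤ → ℝ} {C : ℝ} {p : Om} (h : ∀ x, |F x| ≤ C) : |ext F p| ≤ C :=
  abs_le.2 ⟨le_ext ⟨C, h⟩ fun x => (abs_le.1 (h x)).1, ext_le ⟨C, h⟩ fun x => (abs_le.1 (h x)).2⟩

lemma ext_add {F G : ℤ → ℝ} (hF : Bdd F) (hG : Bdd G) (p : Om) :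
    ext (fun x => F x + G x) p = ext F p + ext G p :=
  ext_eq ((ext_tendsto hF p).add (ext_tendsto hG p))

lemma ext_sub {F G : ℤ → ℝ} (hF : Bdd F) (hG : Bdd G) (p : Om) :
    ext (fun x => F x - G x) p = ext F p - ext G p :=
  ext_eq ((ext_tendsto hF p).sub (ext_tendsto hG p))

lemma ext_mul {F G : ℤ → ℝ} (hF : Bdd F) (hG : Bdd G) (p : Om) :
    ext (fun x => F x * G x) p = ext F p * ext G p :=
  ext_eq ((ext_tendsto hF p).mul (ext_tendsto hG p))

lemma ext_const_mul {F : ℤ → ℝ} (c : ℝ) (hF : Bdd F) (p : Om) :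
    ext (fun x => c * F x) p = c * ext F p :=
  ext_eq ((ext_tendsto hF p).const_mul c)

lemma ext_const (c : ℝ) (p : Om) : ext (fun _ => c) p = c :=
  ext_eq tendsto_const_nhds

lemma ext_sum {ι : Type*} (s : Finset ι) {F : ι → ℤ → ℝ} (hF : ∀ i ∈ s, Bdd (F i)) (p : Om) :
    ext (fun x => ∑ i ∈ s, F i x) p = ∑ i ∈ s, ext (F i) p :=
  ext_eq (tendsto_finsetSum s fun i hi => ext_tendsto (hF i hi) p)

lemma Bdd.add {F G : ℤ → ℝ} (hF : Bdd F) (hG : Bdd G) : Bdd (fun x => F x + G x) := by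
  obtain ⟨C, hC⟩ := hF
  obtain ⟨D, hD⟩ := hG
  exact ⟨C + D, fun x => (abs_add_le _ _).trans (add_le_add (hC x) (hD x))⟩

lemma Bdd.mul {F G : ℤ → ℝ} (hF : Bdd F) (hG : Bdd G) : Bdd (fun x => F x * G x) := by
  obtain ⟨C, hC⟩ := hF
  obtain ⟨D, hD⟩ := hG
  refine ⟨C * D, fun x => ?_⟩
  rw [abs_mul]
  exact mul_le_mul (hC x) (hD x) (abs_nonneg _) ((abs_nonneg _).trans (hC x))

lemma Bdd.const (c : ℝ) : Bdd (fun _ => c) := ⟨|c|, fun _ => le_rfl⟩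

lemma Bdd.const_mul {F : ℤ → ℝ} (c : ℝ) (hF : Bdd F) : Bdd (fun x => c * F x) :=
  (Bdd.const c).mul hF

lemma Bdd.sub {F G : ℤ → ℝ} (hF : Bdd F) (hG : Bdd G) : Bdd (fun x => F x - G x) := by
  have := hF.add (hG.const_mul (-1))
  simpa [sub_eq_add_neg] using this

lemma Bdd.comp {F : ℤ → ℝ} (hF : Bdd F) (g : ℤ → ℤ) : Bdd (fun x => F (g x)) := by
  obtain ⟨C, hC⟩ := hF
  exact ⟨C, fun x => hC _⟩

lemma Bdd.sum {ι : Type*} (s : Finset ι) {F : ι → ℤ → ℝ} (hF : ∀ i ∈ s, Bdd (F i)) :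
    Bdd (fun x => ∑ i ∈ s, F i x) := by
  classical
  induction s using Finset.induction_on with
  | empty => simpa using Bdd.const 0
  | insert a s ha ih =>
    simp only [Finset.sum_insert ha]
    exact (hF a (by simp)).add (ih fun i hi => hF i (by simp [hi]))

lemma Bdd.of01 {F : ℤ → ℝ} (h0 : ∀ x, 0 ≤ F x) (h1 : ∀ x, F x ≤ 1) : Bdd F :=
  ⟨1, fun x => by rw [abs_of_nonneg (h0 x)]; exact h1 x⟩

/-- indicator of a set of integers -/
noncomputable def ind (R : Set ℤ) : ℤ → ℝ := R.indicator 1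

lemma ind_nonneg (R : Set ℤ) (x : ℤ) : 0 ≤ ind R x := Set.indicator_nonneg (by simp) x
lemma ind_le_one (R : Set ℤ) (x : ℤ) : ind R x ≤ 1 :=
  Set.indicator_le_self' (by simp) x
lemma ind_bdd (R : Set ℤ) : Bdd (ind R) := Bdd.of01 (ind_nonneg R) (ind_le_one R)

/-- the clopen set of ultrafilters containing `R`. -/
def hat (R : Set ℤ) : Set Om := {p | R ∈ p}

lemma hat_measurable (R : Set ℤ) : MeasurableSet (hat R) :=
  (ultrafilter_isOpen_basic R).measurableSet

lemma ext_ind (R : Set ℤ) (p : Om) : ext (ind R) p = (hat R).indicator 1 p := by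
  by_cases h : R ∈ p
  · rw [Set.indicator_of_mem (show p ∈ hat R from h)]
    refine ext_eq (tendsto_const_nhds.congr' ?_)
    filter_upwards [show R ∈ (p : Filter ℤ) from h] with x hx
    simp [ind, hx]
  · rw [Set.indicator_of_notMem (show p ∉ hat R from h)]
    refine ext_eq (tendsto_const_nhds.congr' ?_)
    filter_upwards [show Rᶜ ∈ (p : Filter ℤ) from Ultrafilter.compl_mem_iff_notMem.2 h] with x hx
    simp only [ind]; rw [Set.indicator_of_notMem hx]

/-- the shift -/
def tau (h : ℤ) (p : Om) : Om := p.map (· + h)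

lemma tau_tau (h h' : ℤ) (p : Om) : tau h (tau h' p) = tau (h' + h) p := by
  simp only [tau, Ultrafilter.map_map]
  congr 1
  ext x; simp [add_assoc]

lemma tau_zero (p : Om) : tau 0 p = p := by
  simp only [tau, add_zero]
  exact Ultrafilter.map_id' p

lemma tau_continuous (h : ℤ) : Continuous (tau h) := by
  refine ultrafilterBasis_is_basis.continuous_iff.2 ?_
  rintro _ ⟨s, rfl⟩
  exact ultrafilter_isOpen_basic ((· + h) ⁻¹' s)

lemma tau_measurable (h : ℤ) : Measurable (tau h) := (tau_continuous h).measurable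

lemma ext_tau {F : ℤ → ℝ} (hF : Bdd F) (h : ℤ) (p : Om) :
    ext F (tau h p) = ext (fun x => F (x + h)) p := by
  symm
  apply ext_eq
  have := ext_tendsto hF (tau h p)
  simp only [tau, Ultrafilter.coe_map] at this
  exact tendsto_map'_iff.1 this

end SumsetAux

namespace SumsetAux

def tauC : C(Om, Om) := ⟨tau 1, tau_continuous 1⟩

def tauH : Om ≃ₜ Om where
  toFun := tau 1
  invFun := tau (-1)
  left_inv p := by rw [tau_tau]; simp [tau_zero]
  right_inv p := by rw [tau_tau]; simp [tau_zero]
  continuous_toFun := tau_continuous 1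
  continuous_invFun := tau_continuous (-1)

/-- The set of shift-invariant means. -/
def means : Set (C(Om, ℝ) → ℝ) :=
  {Λ | (∀ F G, Λ (F + G) = Λ F + Λ G) ∧ (∀ (c : ℝ) F, Λ (c • F) = c * Λ F) ∧
    (∀ F, 0 ≤ F → 0 ≤ Λ F) ∧ Λ 1 = 1 ∧ ∀ F : C(Om, ℝ), Λ (F.comp tauC) = Λ F}

def box : Set (C(Om, ℝ) → ℝ) := Set.univ.pi fun F => Set.Icc (-‖F‖) ‖F‖

lemma box_compact : IsCompact box := isCompact_univ_pi fun _ => isCompact_Icc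

lemma means_subset_box : means ⊆ box := by
  rintro Λ ⟨hadd, hsmul, hpos, hone, -⟩
  have key : ∀ F : C(Om, ℝ), Λ F ≤ ‖F‖ := by
    intro F
    have h1 : 0 ≤ Λ (‖F‖ • (1 : C(Om, ℝ)) + (-1 : ℝ) • F) := by
      apply hpos
      intro p
      have := (abs_le.1 (F.norm_coe_le_norm p)).2
      simpa using this
    rw [hadd, hsmul, hsmul, hone] at h1
    linarith
  intro F _
  refine ⟨?_, key F⟩
  have := key ((-1 : ℝ) • F)
  rw [hsmul] at this
  have h2 : ‖(-1 : ℝ) • F‖ = ‖F‖ := by rw [norm_smul]; simp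
  rw [h2] at this
  linarith

lemma means_closed : IsClosed means := by
  have e : ∀ F : C(Om, ℝ), Continuous fun Λ : C(Om, ℝ) → ℝ => Λ F := fun F => continuous_apply F
  have h : means = (⋂ F, ⋂ G, {Λ | Λ (F + G) = Λ F + Λ G}) ∩ ((⋂ c : ℝ, ⋂ F, {Λ | Λ (c • F) = c * Λ F}) ∩
      ((⋂ F, ⋂ (_ : 0 ≤ F), {Λ | 0 ≤ Λ F}) ∩ ({Λ | Λ 1 = 1} ∩
        ⋂ F : C(Om, ℝ), {Λ | Λ (F.comp tauC) = Λ F}))) := by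
    apply Set.ext
    intro Λ
    simp only [Set.mem_inter_iff, Set.mem_iInter]
    rfl
  rw [h]
  refine IsClosed.inter ?_ (IsClosed.inter ?_ (IsClosed.inter ?_ (IsClosed.inter ?_ ?_)))
  · exact isClosed_iInter fun F => isClosed_iInter fun G => isClosed_eq (e _) ((e _).add (e _))
  · exact isClosed_iInter fun F => isClosed_iInter fun G =>
      isClosed_eq (e _) (continuous_const.mul (e _))
  · exact isClosed_iInter fun F => isClosed_iInter fun G => isClosed_le continuous_const (e _)
  · exact isClosed_eq (e _) continuous_const
  · exact isClosed_iInter fun F => isClosed_eq (e _) (e _)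

lemma means_compact : IsCompact means := box_compact.of_isClosed_subset means_closed means_subset_box

noncomputable def avg (M : ℕ) (F : C(Om, ℝ)) : ℝ := (∑ y ∈ Finset.range M, F (pure (y : ℤ))) / M

lemma avg_mem_box (M : ℕ) : avg M ∈ box := by
  intro F _
  refine abs_le.1 ?_
  unfold avg
  rw [abs_div, Nat.abs_cast]
  rcases Nat.eq_zero_or_pos M with rfl | hM
  · simp
  · rw [div_le_iff₀ (by exact_mod_cast hM)]
    refine (Finset.abs_sum_le_sum_abs _ _).trans ?_
    refine (Finset.sum_le_card_nsmul _ _ ‖F‖ fun y _ => F.norm_coe_le_norm _).trans ?_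
    simp [mul_comm]

lemma exists_mean (ψ : C(Om, ℝ)) (η : ℝ) (h : ∃ᶠ M : ℕ in atTop, η ≤ avg M ψ) :
    ∃ Λ ∈ means, η ≤ Λ ψ := by
  have hne : (atTop ⊓ 𝓟 {M : ℕ | η ≤ avg M ψ}).NeBot := frequently_iff_neBot.1 h
  let U : Ultrafilter ℕ := Ultrafilter.of (atTop ⊓ 𝓟 {M : ℕ | η ≤ avg M ψ})
  have hU : (U : Filter ℕ) ≤ atTop ⊓ 𝓟 {M : ℕ | η ≤ avg M ψ} := Ultrafilter.of_le _
  have hU1 : (U : Filter ℕ) ≤ atTop := hU.trans inf_le_left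
  have hU2 : ∀ᶠ M in (U : Filter ℕ), η ≤ avg M ψ := (hU.trans inf_le_right) (mem_principal_self _)
  obtain ⟨Λ, -, hΛ⟩ := box_compact.ultrafilter_le_nhds (U.map avg) (by
    rw [le_principal_iff]
    exact Filter.mem_map.2 (Filter.univ_mem' fun x => avg_mem_box x))
  have hT : Tendsto avg U (𝓝 Λ) := hΛ
  have hT' : ∀ F, Tendsto (fun M => avg M F) U (𝓝 (Λ F)) := fun F => (tendsto_pi_nhds.1 hT) F
  refine ⟨Λ, ⟨fun F G => ?_, fun c F => ?_, fun F hF => ?_, ?_, fun F => ?_⟩, ge_of_tendsto (hT' ψ) hU2⟩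
  · refine tendsto_nhds_unique (hT' _) (((hT' F).add (hT' G)).congr fun M => ?_)
    simp [avg, Finset.sum_add_distrib, add_div]
  · refine tendsto_nhds_unique (hT' _) (((hT' F).const_mul c).congr fun M => ?_)
    simp only [avg, ContinuousMap.smul_apply, smul_eq_mul]
    rw [← Finset.mul_sum, mul_div_assoc]
  · refine ge_of_tendsto (hT' F) (Eventually.of_forall fun M => ?_)
    exact div_nonneg (Finset.sum_nonneg fun y _ => hF _) (by positivity)
  · refine tendsto_nhds_unique (hT' 1) (tendsto_const_nhds.congr' ?_)
    filter_upwards [hU1 (eventually_gt_atTop 0)] with M hM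
    have : (M : ℝ) ≠ 0 := by exact_mod_cast hM.ne'
    simp [avg, this]
  · have h0 : Tendsto (fun M : ℕ => avg M (F.comp tauC) - avg M F) U (𝓝 0) := by
      refine Tendsto.mono_left ?_ hU1
      have : Tendsto (fun M : ℕ => (2 * ‖F‖) / (M : ℝ)) atTop (𝓝 0) :=
        tendsto_const_div_atTop_nhds_zero_nat _
      refine squeeze_zero_norm (fun M => ?_) this
      have : avg M (F.comp tauC) - avg M F = (F (pure (M : ℤ)) - F (pure 0)) / M := by
        unfold avg
        rw [← sub_div]
        congr 1
        rw [← Finset.sum_sub_distrib]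
        have := Finset.sum_range_sub (fun y : ℕ => F (pure (y : ℤ))) M
        rw [Nat.cast_zero] at this
        rw [← this]
        refine Finset.sum_congr rfl fun y _ => ?_
        have : tauC (pure (y : ℤ)) = pure ((y : ℤ) + 1) := rfl
        simp [this]
      rw [this, norm_div]
      simp only [Real.norm_natCast]
      gcongr
      have a := F.norm_coe_le_norm (pure (M : ℤ))
      have b := F.norm_coe_le_norm (pure (0 : ℤ))
      have := norm_sub_le (F (pure (M : ℤ))) (F (pure 0))
      linarith
    have := ((hT' (F.comp tauC)).sub (hT' F))
    have := tendsto_nhds_unique this h0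
    linarith

lemma exists_extreme_mean (ψ : C(Om, ℝ)) (h : ∃ Λ ∈ means, 0 < Λ ψ) :
    ∃ Λ ∈ means.extremePoints ℝ, 0 < Λ ψ := by
  obtain ⟨Λ0, h0, hp⟩ := h
  have e : Continuous fun Λ : C(Om, ℝ) → ℝ => Λ ψ := continuous_apply ψ
  obtain ⟨Λ1, h1, hmax⟩ := means_compact.exists_isMaxOn ⟨Λ0, h0⟩ e.continuousOn
  have hmax' : ∀ Λ ∈ means, Λ ψ ≤ Λ1 ψ := fun Λ hΛ => hmax hΛ
  let K' := means ∩ {Λ | Λ ψ = Λ1 ψ}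
  have hK' : IsCompact K' := means_compact.inter_right (isClosed_eq e continuous_const)
  obtain ⟨Λ, hΛ⟩ := hK'.extremePoints_nonempty ⟨Λ1, h1, rfl⟩
  have hΛK : Λ ∈ K' := hΛ.1
  refine ⟨Λ, ⟨hΛK.1, ?_⟩, ?_⟩
  · intro y hy z hz hseg
    have hseg' := hseg
    obtain ⟨a, b, ha, hb, hab, hh⟩ := hseg'
    have e1 : a * y ψ + b * z ψ = Λ1 ψ := by
      have := congrFun hh ψ
      simp only [Pi.add_apply, Pi.smul_apply, smul_eq_mul] at this
      rw [this]; exact hΛK.2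
    have e2 := hmax' y hy
    have e3 := hmax' z hz
    have e0 : a * Λ1 ψ + b * Λ1 ψ = Λ1 ψ := by rw [← add_mul, hab, one_mul]
    have e4 : y ψ = Λ1 ψ := by
      by_contra hne
      have : y ψ < Λ1 ψ := lt_of_le_of_ne e2 hne
      linarith [mul_lt_mul_of_pos_left this ha, mul_le_mul_of_nonneg_left e3 hb.le]
    have e5 : z ψ = Λ1 ψ := by
      by_contra hne
      have : z ψ < Λ1 ψ := lt_of_le_of_ne e3 hne
      linarith [mul_lt_mul_of_pos_left this hb, mul_le_mul_of_nonneg_left e2 ha.le]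
    exact hΛ.2 ⟨hy, e4⟩ ⟨hz, e5⟩ hseg
  · have := hmax' Λ0 h0
    have h3 : Λ ψ = Λ1 ψ := hΛK.2
    linarith

noncomputable def cc (Λ : C(Om, ℝ) → ℝ) (hΛ : Λ ∈ means) : CompactlySupportedContinuousMap Om ℝ →ₚ[ℝ] ℝ where
  toFun g := Λ g.toContinuousMap
  map_add' g g' := hΛ.1 _ _
  map_smul' c g := hΛ.2.1 _ _
  monotone' g g' h := by
    have h1 : (0 : C(Om, ℝ)) ≤ g'.toContinuousMap + (-1 : ℝ) • g.toContinuousMap := by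
      intro p
      have : g p ≤ g' p := h p
      simpa using this
    have := hΛ.2.2.1 _ h1
    rw [hΛ.1, hΛ.2.1] at this
    linarith

lemma regular_ext {μ ν : Measure Om} [μ.Regular] [ν.Regular]
    (h : ∀ F : C(Om, ℝ), ∫ p, F p ∂μ = ∫ p, F p ∂ν) : μ = ν :=
  Measure.ext_of_integral_eq_on_compactlySupported fun f => h f.toContinuousMap

lemma integrable_C (μ : Measure Om) [IsFiniteMeasure μ] (F : C(Om, ℝ)) : Integrable F μ :=
  F.continuous.integrable_of_hasCompactSupport (HasCompactSupport.of_compactSpace _)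

lemma exists_ergodic (ψ : C(Om, ℝ)) (η : ℝ) (hη : 0 < η) (h : ∃ᶠ M : ℕ in atTop, η ≤ avg M ψ) :
    ∃ μ : Measure Om, IsProbabilityMeasure μ ∧ Ergodic (tau 1) μ ∧ 0 < ∫ p, ψ p ∂μ := by
  obtain ⟨Λ0, h0, h0'⟩ := exists_mean ψ η h
  obtain ⟨Λ, hΛ, hpos⟩ := exists_extreme_mean ψ ⟨Λ0, h0, hη.trans_le h0'⟩
  have hm : Λ ∈ means := hΛ.1
  let μ := RealRMK.rieszMeasure (cc Λ hm)
  have hint : ∀ F : C(Om, ℝ), ∫ p, F p ∂μ = Λ F := fun F =>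
    RealRMK.integral_rieszMeasure (cc Λ hm) (CompactlySupportedContinuousMap.continuousMapEquiv F)
  have hprob : IsProbabilityMeasure μ := by
    have := hint 1
    rw [hm.2.2.2.1] at this
    simp only [ContinuousMap.one_apply, integral_const, smul_eq_mul, mul_one] at this
    constructor
    rw [measureReal_def] at this
    rwa [ENNReal.toReal_eq_one_iff] at this
  have hmap : μ.map (tau 1) = μ := by
    have : (μ.map tauH).Regular := Measure.Regular.map tauH
    have : μ.map tauH = μ := by
      apply regular_ext
      intro F
      rw [integral_map tauH.continuous.aemeasurable F.continuous.aestronglyMeasurable, hint,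
        ← hm.2.2.2.2 F, ← hint]
      rfl
    exact this
  have hmp : MeasurePreserving (tau 1) μ μ := ⟨tau_measurable 1, hmap⟩
  refine ⟨μ, hprob, ⟨hmp, ⟨?_⟩⟩, by rw [hint]; exact hpos⟩
  intro E hE hinv
  by_contra hcon
  have hE0 : μ E ≠ 0 := by
    intro h0
    exact hcon (eventuallyConst_set.2 (Or.inr (by
      have := measure_eq_zero_iff_ae_notMem.1 h0
      exact this)))
  have hE1 : μ Eᶜ ≠ 0 := by
    intro h0
    exact hcon (eventuallyConst_set.2 (Or.inl (by
      have := measure_eq_zero_iff_ae_notMem.1 h0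
      filter_upwards [this] with p hp using by simpa using hp)))
  -- conditional means
  have hcond : ∀ E : Set Om, MeasurableSet E → tau 1 ⁻¹' E = E → μ E ≠ 0 →
      (fun F : C(Om, ℝ) => (μ.real E)⁻¹ * ∫ p in E, F p ∂μ) ∈ means := by
    intro E hE hinv hE0
    have hr : μ.real E ≠ 0 := by
      rw [measureReal_def, ENNReal.toReal_ne_zero]; exact ⟨hE0, measure_ne_top _ _⟩
    refine ⟨fun F G => ?_, fun c F => ?_, fun F hF => ?_, ?_, fun F => ?_⟩
    · simp only [ContinuousMap.add_apply]
      rw [integral_add (integrable_C _ F) (integrable_C _ G)]; ring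
    · simp only [ContinuousMap.smul_apply, smul_eq_mul]
      rw [integral_const_mul]; ring
    · exact mul_nonneg (by positivity) (integral_nonneg fun p => hF p)
    · simp [hr]
    · have := hmp.setIntegral_preimage_emb tauH.measurableEmbedding F E
      rw [hinv] at this
      exact congrArg ((μ.real E)⁻¹ * ·) this
  have hLE := hcond E hE hinv hE0
  have hLEc := hcond Eᶜ hE.compl (by rw [Set.preimage_compl, hinv]) hE1
  have hr : 0 < μ.real E := by
    rw [measureReal_def]; exact ENNReal.toReal_pos hE0 (measure_ne_top _ _)
  have hrc : 0 < μ.real Eᶜ := by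
    rw [measureReal_def]; exact ENNReal.toReal_pos hE1 (measure_ne_top _ _)
  have heq := hΛ.2 hLE hLEc ⟨μ.real E, μ.real Eᶜ, hr, hrc, by
      rw [probReal_compl_eq_one_sub hE]; ring, by
      funext F
      simp only [Pi.add_apply, Pi.smul_apply, smul_eq_mul]
      rw [mul_inv_cancel_left₀ hr.ne', mul_inv_cancel_left₀ hrc.ne',
        integral_add_compl hE (integrable_C _ F), hint]⟩
  have hreg1 : (μ.restrict E).Regular := Measure.Regular.restrict_of_measure_ne_top (measure_ne_top _ _)
  have hreg2 : ((μ E) • μ).Regular := Measure.Regular.smul (measure_ne_top _ _)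
  have hfin : μ.restrict E = (μ E) • μ := by
    apply regular_ext
    intro F
    have := congrFun heq F
    rw [integral_smul_measure, hint, ← this, smul_eq_mul, ← measureReal_def,
      mul_inv_cancel_left₀ hr.ne']
  have := congrArg (fun ν : Measure Om => ν Eᶜ) hfin
  simp only [Measure.restrict_apply hE.compl, Set.compl_inter_self, measure_empty,
    Measure.smul_apply, smul_eq_mul] at this
  exact (mul_ne_zero hE0 hE1) this.symm

end SumsetAux

namespace SumsetAux

variable {μ : Measure Om}

lemma mp_tau (hμ : MeasurePreserving (tau 1) μ μ) (h : ℤ) : MeasurePreserving (tau h) μ μ := by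
  have hinv : MeasurePreserving (tau (-1)) μ μ :=
    MeasurePreserving.symm tauH.toMeasurableEquiv hμ
  induction h using Int.induction_on with
  | zero =>
    have : tau 0 = id := funext tau_zero
    rw [this]; exact MeasurePreserving.id μ
  | succ n ih =>
    have : tau ((n : ℤ) + 1) = tau 1 ∘ tau n := funext fun p => (tau_tau _ _ _).symm
    rw [this]; exact hμ.comp ih
  | pred n ih =>
    have : tau (-(n : ℤ) - 1) = tau (-1) ∘ tau (-(n : ℤ)) := funext fun p => (tau_tau _ _ _).symm
    rw [this]; exact hinv.comp ih

lemma integral_tau (hμ : MeasurePreserving (tau 1) μ μ) (h : ℤ) {f : Om → ℝ} (hf : Measurable f) :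
    ∫ p, f (tau h p) ∂μ = ∫ p, f p ∂μ := by
  have := mp_tau hμ h
  conv_rhs => rw [← this.map_eq]
  rw [integral_map this.measurable.aemeasurable hf.aestronglyMeasurable]

lemma measure_tau (hμ : MeasurePreserving (tau 1) μ μ) (h : ℤ) {S : Set Om} (hS : MeasurableSet S) :
    μ.real (tau h ⁻¹' S) = μ.real S :=
  (mp_tau hμ h).measureReal_preimage hS.nullMeasurableSet

lemma integrable_of_le [IsFiniteMeasure μ] {f : Om → ℝ} (hf : Measurable f) (C : ℝ)
    (h : ∀ p, |f p| ≤ C) : Integrable f μ :=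
  Integrable.of_bound hf.aestronglyMeasurable C (Eventually.of_forall h)

lemma ext_integrable [IsFiniteMeasure μ] {F : ℤ → ℝ} (hF : Bdd F) : Integrable (ext F) μ := by
  obtain ⟨C, hC⟩ := hF
  exact integrable_of_le (ext_measurable ⟨C, hC⟩) C fun p => ext_abs_le hC

/-- the invariant mean -/
noncomputable def L (μ : Measure Om) (F : ℤ → ℝ) : ℝ := ∫ p, ext F p ∂μ

section
variable [IsProbabilityMeasure μ]

lemma L_add {F G : ℤ → ℝ} (hF : Bdd F) (hG : Bdd G) :
    L μ (fun x => F x + G x) = L μ F + L μ G := by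
  simp only [L, ext_add hF hG]
  exact integral_add (ext_integrable hF) (ext_integrable hG)

lemma L_sub {F G : ℤ → ℝ} (hF : Bdd F) (hG : Bdd G) :
    L μ (fun x => F x - G x) = L μ F - L μ G := by
  simp only [L, ext_sub hF hG]
  exact integral_sub (ext_integrable hF) (ext_integrable hG)

lemma L_const_mul (c : ℝ) {F : ℤ → ℝ} (hF : Bdd F) :
    L μ (fun x => c * F x) = c * L μ F := by
  simp only [L, ext_const_mul c hF]
  exact integral_const_mul _ _

lemma L_const (c : ℝ) : L μ (fun _ => c) = c := by
  simp [L, ext_const]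

lemma L_mono {F G : ℤ → ℝ} (hF : Bdd F) (hG : Bdd G) (h : ∀ x, F x ≤ G x) : L μ F ≤ L μ G :=
  integral_mono (ext_integrable hF) (ext_integrable hG) fun _ => ext_mono hF hG h

lemma L_nonneg {F : ℤ → ℝ} (hF : Bdd F) (h : ∀ x, 0 ≤ F x) : 0 ≤ L μ F :=
  integral_nonneg fun _ => le_ext hF h

lemma L_sum {ι : Type*} (s : Finset ι) {F : ι → ℤ → ℝ} (hF : ∀ i ∈ s, Bdd (F i)) :
    L μ (fun x => ∑ i ∈ s, F i x) = ∑ i ∈ s, L μ (F i) := by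
  simp only [L, ext_sum s hF]
  exact integral_finsetSum _ fun i hi => ext_integrable (hF i hi)

lemma L_shift (hμ : MeasurePreserving (tau 1) μ μ) {F : ℤ → ℝ} (hF : Bdd F) (h : ℤ) :
    L μ (fun x => F (x + h)) = L μ F := by
  simp only [L, ← ext_tau hF]
  exact integral_tau hμ h (ext_measurable hF)

lemma Bdd.abs {F : ℤ → ℝ} (hF : Bdd F) : Bdd (fun x => |F x|) := by
  obtain ⟨C, hC⟩ := hF
  exact ⟨C, fun x => by rw [abs_abs]; exact hC x⟩

lemma Bdd.sq {F : ℤ → ℝ} (hF : Bdd F) : Bdd (fun x => F x ^ 2) := by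
  simpa [_root_.sq] using hF.mul hF

lemma L_abs_sq {F : ℤ → ℝ} (hF : Bdd F) : (L μ fun x => |F x|) ^ 2 ≤ L μ fun x => F x ^ 2 := by
  set c := L μ fun x => |F x| with hc
  have h1 : 0 ≤ L μ (fun x => (F x ^ 2 - (2 * c) * |F x|) + c ^ 2) := by
    refine L_nonneg ((hF.sq.sub (hF.abs.const_mul _)).add (Bdd.const _)) fun x => ?_
    nlinarith [sq_nonneg (|F x| - c), sq_abs (F x)]
  rw [L_add (hF.sq.sub (hF.abs.const_mul _)) (Bdd.const _), L_sub hF.sq (hF.abs.const_mul _),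
    L_const_mul _ hF.abs, L_const, ← hc] at h1
  nlinarith

lemma L_support (hμ : MeasurePreserving (tau 1) μ μ) (a : ℤ) : L μ (ind {a}) = 0 := by
  have h0 : 0 ≤ L μ (ind {a}) := L_nonneg (ind_bdd _) (ind_nonneg _)
  by_contra hne
  have hpos : 0 < L μ (ind {a}) := lt_of_le_of_ne h0 (Ne.symm hne)
  obtain ⟨n, hn⟩ := exists_nat_gt (1 / L μ (ind {a}))
  have h1 : L μ (fun x => ∑ i ∈ Finset.range n, ind {a} (x + i)) ≤ L μ (fun _ => (1 : ℝ)) := by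
    refine L_mono (Bdd.sum _ fun i _ => (ind_bdd _).comp _) (Bdd.const _) fun x => ?_
    have : ∀ i : ℕ, ind {a} (x + i) = if (i : ℤ) = a - x then 1 else 0 := by
      intro i
      simp only [ind, Set.indicator, Set.mem_singleton_iff, Pi.one_apply]
      congr 1
      exact propext ⟨fun h => by omega, fun h => by omega⟩
    simp only [this]
    rw [← Finset.sum_filter, Finset.sum_const, nsmul_eq_mul, mul_one]
    have : (Finset.filter (fun i : ℕ => (i : ℤ) = a - x) (Finset.range n)).card ≤ 1 :=
      Finset.card_le_one.2 fun i hi j hj => by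
        simp only [Finset.mem_filter] at hi hj; omega
    exact_mod_cast this
  rw [L_sum _ fun i _ => (ind_bdd _).comp _, L_const] at h1
  simp only [L_shift hμ (ind_bdd _)] at h1
  rw [Finset.sum_const, Finset.card_range, nsmul_eq_mul] at h1
  rw [div_lt_iff₀ hpos] at hn
  linarith

lemma L_finset (hμ : MeasurePreserving (tau 1) μ μ) (s : Finset ℤ) : L μ (ind s) = 0 := by
  have : ind s = fun x => ∑ a ∈ s, ind {a} x := by
    funext x
    simp [ind, Set.indicator_apply]
  rw [this, L_sum _ fun i _ => ind_bdd _]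
  exact Finset.sum_eq_zero fun a _ => L_support hμ a

lemma int_abs_le_norm (G : Lp ℝ 2 μ) : ∫ p, |G p| ∂μ ≤ ‖G‖ := by
  have h1 : ∫ p, |G p| ∂μ = (eLpNorm G 1 μ).toReal := by
    have := integral_norm_eq_lintegral_enorm (Lp.aestronglyMeasurable G)
    rw [eLpNorm_one_eq_lintegral_enorm]
    exact this
  rw [h1, Lp.norm_def]
  exact ENNReal.toReal_mono (Lp.eLpNorm_ne_top G)
    (eLpNorm_le_eLpNorm_of_exponent_le (by norm_num) (Lp.aestronglyMeasurable G))

/-- mean ergodic theorem, in the form used here. -/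
lemma met (hμ : Ergodic (tau 1) μ) {f : Om → ℝ} (hf : Measurable f) {C : ℝ} (hC : ∀ p, |f p| ≤ C) :
    Tendsto (fun N : ℕ => ∫ p, |(N : ℝ)⁻¹ * ∑ s ∈ Finset.range N, f (tau s p) - ∫ q, f q ∂μ| ∂μ)
      atTop (𝓝 0) := by
  have hmp := hμ.toMeasurePreserving
  have hmem : MemLp f 2 μ := MemLp.of_bound hf.aestronglyMeasurable C (Eventually.of_forall hC)
  let U : Lp ℝ 2 μ →ₗᵢ[ℝ] Lp ℝ 2 μ := Lp.compMeasurePreservingₗᵢ ℝ (tau 1) hmp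
  let U' : Lp ℝ 2 μ →L[ℝ] Lp ℝ 2 μ := U.toContinuousLinearMap
  have hU' : ‖U'‖ ≤ 1 := U.norm_toContinuousLinearMap_le
  have hUae : ∀ G : Lp ℝ 2 μ, U' G =ᵐ[μ] G ∘ tau 1 := fun G => Lp.coeFn_compMeasurePreserving G hmp
  let F : Lp ℝ 2 μ := hmem.toLp f
  have hlim := U'.tendsto_birkhoffAverage_orthogonalProjection hU' F
  obtain ⟨P, hPF, hlim⟩ : ∃ P : Lp ℝ 2 μ, U' P = P ∧
      Tendsto (birkhoffAverage ℝ U' _root_.id · F) atTop (𝓝 P) := by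
    refine ⟨_, ?_, hlim⟩
    exact ((U'.eqLocus (1 : Lp ℝ 2 μ →L[ℝ] Lp ℝ 2 μ)).orthogonalProjectionOnto F).2
  obtain ⟨c, hc⟩ := hμ.ae_eq_const_of_ae_eq_comp_ae (g := P) (Lp.aestronglyMeasurable P)
    (by have := hUae P; rw [hPF] at this; exact this.symm)
  have hit : ∀ s : ℕ, (U'^[s] F : Lp ℝ 2 μ) =ᵐ[μ] fun p => f (tau s p) := by
    intro s
    induction s with
    | zero =>
      filter_upwards [hmem.coeFn_toLp] with p hp
      simpa [tau_zero] using hp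
    | succ s ih =>
      rw [Function.iterate_succ_apply']
      filter_upwards [hUae (U'^[s] F), hmp.quasiMeasurePreserving.ae ih] with p h1 h2
      rw [h1, Function.comp_apply, h2, tau_tau]
      push_cast
      rw [add_comm]
  have hb : ∀ N : ℕ, (birkhoffAverage ℝ U' _root_.id N F : Lp ℝ 2 μ) =ᵐ[μ]
      fun p => (N : ℝ)⁻¹ * ∑ s ∈ Finset.range N, f (tau s p) := by
    intro N
    unfold birkhoffAverage birkhoffSum
    have h1 := Lp.coeFn_smul ((N : ℝ)⁻¹) (∑ s ∈ Finset.range N, (U'^[s] F))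
    have h2 : (↑(∑ s ∈ Finset.range N, (U'^[s] F)) : Om → ℝ) =ᵐ[μ]
        fun p => ∑ s ∈ Finset.range N, f (tau s p) := by
      induction N with
      | zero =>
        filter_upwards [Lp.coeFn_zero ℝ 2 μ] with p hp
        simpa using hp
      | succ N ih =>
        rw [Finset.sum_range_succ]
        filter_upwards [Lp.coeFn_add (∑ s ∈ Finset.range N, (U'^[s] F)) (U'^[N] F),
          ih (Lp.coeFn_smul ((N : ℝ)⁻¹) (∑ s ∈ Finset.range N, (U'^[s] F))), hit N] with p h1 h2 h3
        rw [h1, Pi.add_apply, h2, h3, Finset.sum_range_succ]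
    filter_upwards [h1, h2] with p h1 h2
    simp only [id]
    rw [h1, Pi.smul_apply, h2, smul_eq_mul]
  have hnorm : Tendsto (fun N : ℕ => ‖birkhoffAverage ℝ U' _root_.id N F - P‖) atTop (𝓝 0) :=
    tendsto_iff_norm_sub_tendsto_zero.1 hlim
  have hkey : Tendsto (fun N : ℕ =>
      ∫ p, |(N : ℝ)⁻¹ * ∑ s ∈ Finset.range N, f (tau s p) - c| ∂μ) atTop (𝓝 0) := by
    refine squeeze_zero (fun N => integral_nonneg fun p => abs_nonneg _) (fun N => ?_) hnorm
    refine le_trans (le_of_eq ?_) (int_abs_le_norm _)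
    refine integral_congr_ae ?_
    filter_upwards [hb N, hc, Lp.coeFn_sub (birkhoffAverage ℝ U' _root_.id N F) P] with p h1 h2 h3
    rw [h3, Pi.sub_apply, h1, h2]
    rfl
  have hcf : ∫ q, f q ∂μ = c := by
    have hle : ∀ᶠ N : ℕ in atTop, |∫ q, f q ∂μ - c| ≤
        ∫ p, |(N : ℝ)⁻¹ * ∑ s ∈ Finset.range N, f (tau s p) - c| ∂μ := by
      filter_upwards [eventually_gt_atTop 0] with N hN
      have hN' : (N : ℝ) ≠ 0 := by exact_mod_cast hN.ne'
      have hi : ∀ s : ℕ, Integrable (fun p => f (tau s p)) μ := fun s =>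
        integrable_of_le (hf.comp (tau_measurable s)) C fun p => hC _
      have : ∫ p, ((N : ℝ)⁻¹ * ∑ s ∈ Finset.range N, f (tau s p) - c) ∂μ = ∫ q, f q ∂μ - c := by
        rw [integral_sub ((integrable_finsetSum _ fun s _ => hi s).const_mul _) (integrable_const _),
          integral_const_mul, integral_finsetSum _ fun s _ => hi s]
        simp only [integral_tau hmp _ hf]
        simp [hN']
      rw [← this]
      exact abs_integral_le_integral_abs
    have := ge_of_tendsto hkey hle
    have := abs_nonpos_iff.1 this
    linarith
  rw [hcf]
  exact hkey

end
end SumsetAux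

namespace SumsetAux

variable {μ : Measure Om}

/-- total boundedness of a pseudometric on the integers, via finite colorings -/
def TB (ρ : ℤ → ℤ → ℝ) : Prop :=
  ∀ ε : ℝ, 0 < ε → ∃ (ι : Type) (_ : Finite ι) (c : ℤ → ι), ∀ x y, c x = c y → ρ x y ≤ ε

lemma TB.rep {ρ : ℤ → ℤ → ℝ} (h : TB ρ) {ε : ℝ} (hε : 0 < ε) :
    ∃ r : ℤ → ℤ, (Set.range r).Finite ∧ ∀ x, ρ x (r x) ≤ ε := by
  obtain ⟨ι, _, c, hc⟩ := h ε hε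
  refine ⟨Function.invFun c ∘ c, ?_, fun x => hc _ _ ?_⟩
  · exact (Set.finite_range (Function.invFun c)).subset (Set.range_comp_subset_range _ _)
  · exact (Function.invFun_eq ⟨x, rfl⟩).symm

lemma TB.sum {ι : Type*} (s : Finset ι) {ρ : ι → ℤ → ℤ → ℝ} (h : ∀ i ∈ s, TB (ρ i)) :
    TB (fun x y => ∑ i ∈ s, ρ i x y) := by
  classical
  induction s using Finset.induction_on with
  | empty => exact fun ε hε => ⟨Unit, inferInstance, fun _ => (), fun x y _ => by simpa using hε.le⟩
  | insert a s ha ih =>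
    intro ε hε
    obtain ⟨ι1, _, c1, h1⟩ := h a (by simp) (ε / 2) (by positivity)
    obtain ⟨ι2, _, c2, h2⟩ := ih (fun i hi => h i (by simp [hi])) (ε / 2) (by positivity)
    refine ⟨ι1 × ι2, inferInstance, fun x => (c1 x, c2 x), fun x y hxy => ?_⟩
    rw [Prod.mk.injEq] at hxy
    beta_reduce at h2 ⊢
    rw [Finset.sum_insert ha]
    have := h1 x y hxy.1
    have := h2 x y hxy.2
    linarith

lemma tb_hilbert [IsProbabilityMeasure μ] {H : Type} [NormedAddCommGroup H] [InnerProductSpace ℝ H]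
    (α t : ℤ → H) (hα : ∀ b, ‖α b‖ ≤ 1)
    (ht : ∀ a g, |inner ℝ (t a) g| ≤ L μ (fun b => |inner ℝ (α b) g|)) :
    TB (fun x y => ‖t x - t y‖) := by
  classical
  have hbd : ∀ g, Bdd (fun b => inner ℝ (α b) g) := fun g => ⟨‖g‖, fun b =>
    (abs_real_inner_le_norm _ _).trans (mul_le_of_le_one_left (norm_nonneg _) (hα b))⟩
  have ht1 : ∀ a, ‖t a‖ ≤ 1 := by
    intro a
    have h1 := ht a (t a)
    have h2 : L μ (fun b => |inner ℝ (α b) (t a)|) ≤ L μ (fun _ => ‖t a‖) :=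
      L_mono (hbd _).abs (Bdd.const _) fun b =>
        (abs_real_inner_le_norm _ _).trans (mul_le_of_le_one_left (norm_nonneg _) (hα b))
    rw [L_const] at h2
    rw [real_inner_self_eq_norm_sq, abs_of_nonneg (sq_nonneg _)] at h1
    by_contra hcon
    push Not at hcon
    nlinarith
  intro ε' hε'
  set ε := ε' / 4 with hεdef
  have hε : 0 < ε := by positivity
  let q : H → ℝ := fun g => L μ (fun b => (inner ℝ (α b) g) ^ 2)
  have hbessel : ∀ s : Finset H, Orthonormal ℝ (Subtype.val : s → H) → ∑ v ∈ s, q v ≤ 1 := by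
    intro s hs
    simp only [q]
    rw [← L_sum s fun v _ => (hbd v).sq]
    refine (L_mono (Bdd.sum s fun v _ => (hbd v).sq) (Bdd.const 1) fun b => ?_).trans (L_const _).le
    have h1 := hs.sum_inner_products_le (x := α b) (s := Finset.univ)
    have h2 : ∑ v ∈ s, (inner ℝ (α b) v) ^ 2 = ∑ v : s, ‖inner ℝ (v : H) (α b)‖ ^ 2 := by
      rw [← Finset.sum_coe_sort s]
      refine Finset.sum_congr rfl fun v _ => ?_
      rw [Real.norm_eq_abs, sq_abs, real_inner_comm]
    rw [h2]
    exact h1.trans (pow_le_one₀ (norm_nonneg _) (hα b))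
  let good : ℕ → Prop := fun n => ∃ s : Finset H, s.card = n ∧
    Orthonormal ℝ (Subtype.val : s → H) ∧ ∀ v ∈ s, ε ^ 2 ≤ q v
  obtain ⟨N, hN⟩ := exists_nat_gt (1 / ε ^ 2)
  have hbound : ∀ n, good n → n ≤ N := by
    rintro n ⟨s, rfl, hs, hq⟩
    have h1 := hbessel s hs
    have h2 := Finset.card_nsmul_le_sum s q (ε ^ 2) hq
    rw [nsmul_eq_mul] at h2
    have h3 : (s.card : ℝ) ≤ 1 / ε ^ 2 := by
      rw [le_div_iff₀ (by positivity)]; linarith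
    exact_mod_cast (h3.trans hN.le)
  have h0 : good 0 := ⟨∅, rfl, ⟨fun v => absurd v.2 (Finset.notMem_empty _), fun v => absurd v.2 (Finset.notMem_empty _)⟩, by simp⟩
  have hg := Nat.findGreatest_spec (P := good) (Nat.zero_le N) h0
  obtain ⟨s, hsc, hs, hq⟩ := hg
  let E : Submodule ℝ H := Submodule.span ℝ (s : Set H)
  have hfd : FiniteDimensional ℝ E := FiniteDimensional.span_finset ℝ s
  have hsmall : ∀ g ∈ Eᗮ, ‖g‖ = 1 → q g < ε ^ 2 := by
    intro g hgE hg1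
    by_contra hcon
    push Not at hcon
    have hort : ∀ v ∈ s, inner ℝ v g = 0 := fun v hv => hgE v (Submodule.subset_span hv)
    have hgs : g ∉ s := by
      intro hgs
      have := hort g hgs
      rw [real_inner_self_eq_norm_sq, hg1] at this
      norm_num at this
    have : good (s.card + 1) := by
      refine ⟨insert g s, Finset.card_insert_of_notMem hgs, ?_, ?_⟩
      · have hs' := orthonormal_subtype_iff_ite.1 hs
        have : Orthonormal ℝ (Subtype.val : (↑(insert g s) : Set H) → H) := by
          rw [orthonormal_subtype_iff_ite]
          intro v hv w hw
          simp only [Finset.coe_insert, Set.mem_insert_iff, Finset.mem_coe] at hv hw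
          rcases hv with rfl | hv <;> rcases hw with rfl | hw
          · simp [real_inner_self_eq_norm_sq, hg1]
          · rw [real_inner_comm, hort w hw, if_neg]; rintro rfl; exact hgs hw
          · rw [hort v hv, if_neg]; rintro rfl; exact hgs hv
          · exact hs' v hv w hw
        exact this
      · intro v hv
        rcases Finset.mem_insert.1 hv with rfl | hv
        · exact hcon
        · exact hq v hv
    have h2 := Nat.le_findGreatest (hbound _ this) this
    omega
  have hres : ∀ a, ‖t a - E.starProjection (t a)‖ ≤ ε := by
    intro a
    set g := t a - E.starProjection (t a) with hgdef
    have hgE : g ∈ Eᗮ := E.sub_starProjection_mem_orthogonal (t a)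
    by_cases hg0 : g = 0
    · rw [hg0, norm_zero]; exact hε.le
    have hgn : ‖g‖ ≠ 0 := norm_ne_zero_iff.2 hg0
    set e := ‖g‖⁻¹ • g with he
    have heE : e ∈ Eᗮ := Eᗮ.smul_mem _ hgE
    have he1 : ‖e‖ = 1 := by rw [he, norm_smul, norm_inv, norm_norm, inv_mul_cancel₀ hgn]
    have h1 := hsmall e heE he1
    have h2 := ht a e
    have h3 := L_abs_sq (μ := μ) (hbd e)
    have h4 : L μ (fun b => |inner ℝ (α b) e|) < ε := by
      apply lt_of_pow_lt_pow_left₀ 2 hε.le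
      exact h3.trans_lt h1
    have h5 : inner ℝ (t a) e = ‖g‖ := by
      have : t a = g + E.starProjection (t a) := by rw [hgdef]; abel
      have h6 : inner ℝ (E.starProjection (t a)) e = 0 := heE _ (E.starProjection_apply_mem _)
      rw [this, inner_add_left, h6, add_zero, he, inner_smul_right, real_inner_self_eq_norm_sq]
      field_simp
    rw [h5, abs_of_nonneg (norm_nonneg _)] at h2
    linarith
  obtain ⟨T, -, hTf, hT⟩ := (isCompact_closedBall (0 : E) 1).finite_cover_balls hε
  have hcov : ∀ a, ∃ z : T, ‖E.starProjection (t a) - (z : E)‖ < ε := by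
    intro a
    have : (E.orthogonalProjectionOnto (t a)) ∈ Metric.closedBall (0 : E) 1 := by
      rw [mem_closedBall_zero_iff]
      exact (E.norm_orthogonalProjectionOnto_apply_le (t a)).trans (ht1 a)
    obtain ⟨z, hz, hz'⟩ := Set.mem_iUnion₂.1 (hT this)
    refine ⟨⟨z, hz⟩, ?_⟩
    rw [Metric.mem_ball, dist_eq_norm] at hz'
    exact hz'
  choose c hc using hcov
  have := hTf.to_subtype
  refine ⟨T, inferInstance, c, fun x y hxy => ?_⟩
  have h1 := hres x
  have h2 := hres y
  have h3 := (hc x).le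
  have h4 := (hc y).le
  rw [hxy] at h3
  have : t x - t y = (t x - E.starProjection (t x)) + (E.starProjection (t x) - ((c y : E) : H))
      - (E.starProjection (t y) - ((c y : E) : H)) - (t y - E.starProjection (t y)) := by abel
  beta_reduce
  rw [this]
  have := norm_sub_le ((t x - E.starProjection (t x)) + (E.starProjection (t x) - ((c y : E) : H))
      - (E.starProjection (t y) - ((c y : E) : H))) (t y - E.starProjection (t y))
  have := norm_sub_le ((t x - E.starProjection (t x)) + (E.starProjection (t x) - ((c y : E) : H)))
      (E.starProjection (t y) - ((c y : E) : H))
  have := norm_add_le (t x - E.starProjection (t x)) (E.starProjection (t x) - ((c y : E) : H))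
  linarith

end SumsetAux

namespace SumsetAux

variable {μ : Measure Om}

/-- `R_b = {n : m b + ℓ n ∈ A}` -/
def Rset (ℓ m : ℕ) (A : Set ℤ) (b : ℤ) : Set ℤ := {n | (m : ℤ) * b + ℓ * n ∈ A}

lemma Rset_tau (ℓ m : ℕ) (A : Set ℤ) (b a : ℤ) :
    tau (m * a) ⁻¹' (hat (Rset ℓ m A b)) = hat (Rset ℓ m A (b + ℓ * a)) := by
  apply Set.ext
  intro p
  have : (fun x : ℤ => x + m * a) ⁻¹' (Rset ℓ m A b) = Rset ℓ m A (b + ℓ * a) := by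
    apply Set.ext
    intro n
    simp only [Rset, Set.mem_preimage, Set.mem_ofPred_eq]
    rw [show (m : ℤ) * b + ℓ * (n + m * a) = m * (b + ℓ * a) + ℓ * n by ring]
  rw [← this]
  rfl

/-- measure of the part of `S` on which `R_b` is chosen -/
noncomputable def wS (μ : Measure Om) (ℓ m : ℕ) (A : Set ℤ) (S : Set Om) (b : ℤ) : ℝ :=
  μ.real (hat (Rset ℓ m A b) ∩ S)

/-- Bad sets -/
def Bad (μ : Measure Om) (ℓ m : ℕ) (A : Set ℤ) (S : Set Om) : Prop :=
  ∫ p in S, ext (wS μ ℓ m A S) p ∂μ = 0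

section
variable [IsProbabilityMeasure μ]

lemma wS_bdd (ℓ m : ℕ) (A : Set ℤ) (S : Set Om) : Bdd (wS μ ℓ m A S) :=
  Bdd.of01 (fun _ => measureReal_nonneg) (fun _ => measureReal_le_one)

/-- Koopman operator -/
noncomputable def Ko (hμ : MeasurePreserving (tau 1) μ μ) (h : ℤ) : Lp ℝ 2 μ →ₗᵢ[ℝ] Lp ℝ 2 μ :=
  Lp.compMeasurePreservingₗᵢ ℝ (tau h) (mp_tau hμ h)

lemma Ko_ae (hμ : MeasurePreserving (tau 1) μ μ) (h : ℤ) (G : Lp ℝ 2 μ) :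
    Ko hμ h G =ᵐ[μ] fun p => G (tau h p) := Lp.coeFn_compMeasurePreserving G (mp_tau hμ h)

lemma Ko_adj (hμ : MeasurePreserving (tau 1) μ μ) (h : ℤ) (F G : Lp ℝ 2 μ) :
    inner ℝ (Ko hμ h F) G = inner ℝ F (Ko hμ (-h) G) := by
  rw [L2.inner_def, L2.inner_def]
  have h1 : ∫ p, inner ℝ (Ko hμ h F p) (G p) ∂μ
      = ∫ p, (fun p => inner ℝ (F p) (G (tau (-h) p))) (tau h p) ∂μ := by
    refine integral_congr_ae ?_
    filter_upwards [Ko_ae hμ h F] with p hp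
    rw [hp, tau_tau]
    simp [tau_zero]
  rw [h1, integral_tau hμ h (f := fun p => inner ℝ (F p) (G (tau (-h) p)))]
  · refine integral_congr_ae ?_
    filter_upwards [Ko_ae hμ (-h) G] with p hp
    rw [hp]
  · have a := (Lp.stronglyMeasurable F).measurable
    have b := (Lp.stronglyMeasurable G).measurable.comp (tau_measurable (-h))
    exact a.inner b

noncomputable def al (μ : Measure Om) [IsProbabilityMeasure μ] (ℓ m : ℕ) (A : Set ℤ) (b : ℤ) :
    Lp ℝ 2 μ :=
  indicatorConstLp 2 (hat_measurable (Rset ℓ m A b)) (measure_ne_top _ _) 1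

lemma al_norm (ℓ m : ℕ) (A : Set ℤ) (b : ℤ) : ‖al μ ℓ m A b‖ ≤ 1 := by
  unfold al
  rw [norm_indicatorConstLp (by norm_num) (by norm_num)]
  rw [norm_one, one_mul]
  exact Real.rpow_le_one measureReal_nonneg measureReal_le_one (by positivity)

lemma al_Ko (hμ : MeasurePreserving (tau 1) μ μ) (ℓ m : ℕ) (A : Set ℤ) (b a : ℤ) :
    Ko hμ (m * a) (al μ ℓ m A b) = al μ ℓ m A (b + ℓ * a) := by
  unfold Ko al
  have := Lp.indicatorConstLp_compMeasurePreserving (p := 2) (hat_measurable (Rset ℓ m A b))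
    (measure_ne_top μ _) (1 : ℝ) (mp_tau hμ (m * a))
  refine this.trans ?_
  congr 1
  exact Rset_tau ℓ m A b a

lemma al_inner (ℓ m : ℕ) (A : Set ℤ) (b : ℤ) {E : Set Om} (hE : MeasurableSet E) :
    inner ℝ (al μ ℓ m A b) (indicatorConstLp 2 hE (measure_ne_top μ _) (1 : ℝ)) =
      wS μ ℓ m A E b := by
  unfold al
  have h1 := indicatorConstLp_coeFn (p := 2) (hs := hE) (hμs := measure_ne_top μ _) (c := (1 : ℝ))
  have h2 : ∀ᵐ p ∂μ, p ∈ hat (Rset ℓ m A b) →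
      (indicatorConstLp 2 hE (measure_ne_top μ _) (1 : ℝ)) p = E.indicator (fun _ => (1 : ℝ)) p := by
    filter_upwards [h1] with p hp _ using hp
  rw [L2.inner_indicatorConstLp_one, setIntegral_congr_ae (hat_measurable _) h2]
  rw [setIntegral_indicator hE]
  simp [wS]

lemma al_bdd (ℓ m : ℕ) (A : Set ℤ) (g : Lp ℝ 2 μ) : Bdd (fun b => inner ℝ (al μ ℓ m A b) g) :=
  ⟨‖g‖, fun b =>
    (abs_real_inner_le_norm _ _).trans (mul_le_of_le_one_left (norm_nonneg _) (al_norm ℓ m A b))⟩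

lemma exists_u (ℓ m : ℕ) (A : Set ℤ) (S : Set Om) :
    ∃ u : Lp ℝ 2 μ, ∀ g, inner ℝ u g = ∫ p in S, ext (fun b => inner ℝ (al μ ℓ m A b) g) p ∂μ := by
  let φ : Lp ℝ 2 μ →ₗ[ℝ] ℝ :=
    { toFun := fun g => ∫ p in S, ext (fun b => inner ℝ (al μ ℓ m A b) g) p ∂μ
      map_add' := fun g g' => by
        simp only [inner_add_right]
        rw [← integral_add (ext_integrable (al_bdd ℓ m A g)) (ext_integrable (al_bdd ℓ m A g'))]
        simp only [ext_add (al_bdd ℓ m A g) (al_bdd ℓ m A g')]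
      map_smul' := fun c g => by
        simp only [inner_smul_right, ext_const_mul c (al_bdd ℓ m A g), RingHom.id_apply, smul_eq_mul]
        rw [integral_const_mul] }
  have hφ : ∀ g, ‖φ g‖ ≤ 1 * ‖g‖ := by
    intro g
    have := norm_setIntegral_le_of_norm_le_const (μ := μ) (s := S) (C := ‖g‖)
      (f := ext (fun b => inner ℝ (al μ ℓ m A b) g)) (measure_lt_top _ _) (fun p _ =>
        ext_abs_le fun b => (abs_real_inner_le_norm _ _).trans
          (mul_le_of_le_one_left (norm_nonneg _) (al_norm ℓ m A b)))
    refine this.trans ?_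
    rw [mul_comm]
    exact mul_le_mul_of_nonneg_right measureReal_le_one (norm_nonneg _)
  refine ⟨(InnerProductSpace.toDual ℝ (Lp ℝ 2 μ)).symm (φ.mkContinuous 1 hφ), fun g => ?_⟩
  rw [InnerProductSpace.toDual_symm_apply]
  rfl

lemma setIntegral_ext_abs_le (S : Set Om) {F : ℤ → ℝ} (hF : Bdd F) :
    |∫ p in S, ext F p ∂μ| ≤ L μ fun b => |F b| := by
  refine abs_integral_le_integral_abs.trans ?_
  have h1 : ∀ p, |ext F p| = ext (fun b => |F b|) p := fun p =>
    (ext_eq ((ext_tendsto hF p).abs)).symm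
  simp only [h1]
  exact setIntegral_le_integral (ext_integrable hF.abs)
    (Eventually.of_forall fun p => le_ext hF.abs fun b => abs_nonneg _)

lemma tb_u (hμ : MeasurePreserving (tau 1) μ μ) (ℓ m : ℕ) (hm : 0 < m) (A : Set ℤ) (S : Set Om)
    (u : Lp ℝ 2 μ)
    (hu : ∀ g, inner ℝ u g = ∫ p in S, ext (fun b => inner ℝ (al μ ℓ m A b) g) p ∂μ) :
    TB (fun x y => ∫ p, |u (tau x p) - u (tau y p)| ∂μ) := by
  have h1 : TB (fun x y => ‖Ko hμ (m * x) u - Ko hμ (m * y) u‖) := by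
    refine tb_hilbert (μ := μ) (al μ ℓ m A) (fun a => Ko hμ (m * a) u) (al_norm ℓ m A) ?_
    intro a g
    rw [Ko_adj, hu]
    have : ∀ b, inner ℝ (al μ ℓ m A b) (Ko hμ (-(m * a)) g) =
        inner ℝ (al μ ℓ m A (b + ℓ * a)) g := fun b => by rw [← Ko_adj, al_Ko]
    simp only [this]
    refine (setIntegral_ext_abs_le S ((al_bdd ℓ m A g).comp (· + ℓ * a))).trans ?_
    rw [L_shift hμ (F := fun b => |inner ℝ (al μ ℓ m A b) g|) (al_bdd ℓ m A g).abs]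
  intro ε hε
  obtain ⟨ι, _, c, hc⟩ := h1 ε hε
  have : NeZero m := ⟨hm.ne'⟩
  refine ⟨ι × ZMod m, inferInstance, fun x => (c (x / m), (x : ZMod m)), fun x y hxy => ?_⟩
  rw [Prod.mk.injEq, ZMod.intCast_eq_intCast_iff'] at hxy
  refine le_trans ?_ (hc _ _ hxy.1)
  refine le_trans (le_of_eq ?_) (int_abs_le_norm _)
  have hum := (Lp.stronglyMeasurable u).measurable
  have h2 : ∫ p, |u (tau x p) - u (tau y p)| ∂μ =
      ∫ p, (fun p => |u (tau (m * (x / m)) p) - u (tau (m * (y / m)) p)|) (tau (x % m) p) ∂μ := by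
    refine integral_congr_ae (Eventually.of_forall fun p => ?_)
    simp only [tau_tau]
    rw [Int.emod_add_mul_ediv x m, hxy.2, Int.emod_add_mul_ediv y m]
  beta_reduce
  rw [h2, integral_tau hμ _ (f := fun p => |u (tau (m * (x / m)) p) - u (tau (m * (y / m)) p)|)]
  · refine integral_congr_ae ?_
    filter_upwards [Ko_ae hμ (m * (x / m)) u, Ko_ae hμ (m * (y / m)) u,
      Lp.coeFn_sub (Ko hμ (m * (x / m)) u) (Ko hμ (m * (y / m)) u)] with p h1 h2 h3
    rw [h3, Pi.sub_apply, h1, h2]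
  · exact ((hum.comp (tau_measurable _)).sub (hum.comp (tau_measurable _))).abs

/-- translation pseudometric attached to a set -/
noncomputable def rhoQ (μ : Measure Om) (Q : Set Om) (x y : ℤ) : ℝ :=
  ∫ p, |Q.indicator (fun _ => (1 : ℝ)) (tau x p) - Q.indicator (fun _ => (1 : ℝ)) (tau y p)| ∂μ

lemma tb_Q (hμ : MeasurePreserving (tau 1) μ μ) {u : Om → ℝ} (hum : Measurable u)
    (hui : Integrable u μ) (h : TB (fun x y => ∫ p, |u (tau x p) - u (tau y p)| ∂μ)) :
    TB (rhoQ μ {p | 0 < u p}) := by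
  set Q : Set Om := {p | 0 < u p} with hQ
  have hQm : MeasurableSet Q := measurableSet_lt measurable_const hum
  set q : Om → ℝ := Q.indicator (fun _ => (1 : ℝ)) with hq
  have hqm : Measurable q := measurable_const.indicator hQm
  have hq01 : ∀ p, 0 ≤ q p ∧ q p ≤ 1 := fun p => by
    by_cases hp : p ∈ Q <;> simp [hq, hp]
  let f : ℕ → Om → ℝ := fun n p => min 1 (n * max (u p) 0)
  have hfm : ∀ n, Measurable (f n) := fun n =>
    measurable_const.min ((hum.max measurable_const).const_mul _)
  have hf01 : ∀ n p, 0 ≤ f n p ∧ f n p ≤ 1 := fun n p =>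
    ⟨le_min zero_le_one (by positivity), min_le_left _ _⟩
  have hdiff : ∀ n p, |q p - f n p| ≤ 1 := fun n p => by
    rw [abs_le]; constructor <;> linarith [(hq01 p).1, (hq01 p).2, (hf01 n p).1, (hf01 n p).2]
  have hlim : Tendsto (fun n => ∫ p, |q p - f n p| ∂μ) atTop (𝓝 (∫ _, (0 : ℝ) ∂μ)) := by
    refine tendsto_integral_of_dominated_convergence (fun _ => 1)
      (fun n => (hqm.sub (hfm n)).abs.aestronglyMeasurable) (integrable_const _)
      (fun n => Eventually.of_forall fun p => by
        rw [Real.norm_eq_abs, abs_abs]; exact hdiff n p) (Eventually.of_forall fun p => ?_)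
    by_cases hp : p ∈ Q
    · have hp' : 0 < u p := hp
      obtain ⟨N, hN⟩ := exists_nat_gt (1 / u p)
      refine tendsto_const_nhds.congr' ?_
      filter_upwards [eventually_ge_atTop N] with n hn
      have h1 : (1 : ℝ) ≤ n * max (u p) 0 := by
        rw [max_eq_left hp'.le]
        rw [div_lt_iff₀ hp'] at hN
        have : (N : ℝ) ≤ n := by exact_mod_cast hn
        nlinarith
      simp [f, hq, hp, min_eq_left h1]
    · have hp' : u p ≤ 0 := not_lt.1 hp
      have : ∀ n, |q p - f n p| = 0 := fun n => by simp [f, hq, hp, max_eq_right hp']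
      simp only [this]
      exact tendsto_const_nhds
  rw [integral_zero] at hlim
  intro ε hε
  obtain ⟨n, hn⟩ := ((tendsto_order.1 hlim).2 (ε / 4) (by positivity)).exists
  obtain ⟨ι, hι, c, hc⟩ := h (ε / (2 * (n + 1))) (by positivity)
  refine ⟨ι, hι, c, fun x y hxy => ?_⟩
  have hxy' := hc x y hxy
  beta_reduce at hxy'
  have hm1 : ∀ z : ℤ, Integrable (fun p => |q (tau z p) - f n (tau z p)|) μ := fun z =>
    integrable_of_le ((hqm.sub (hfm n)).abs.comp (tau_measurable z)) 1 fun p => by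
      rw [abs_abs]; exact hdiff n _
  have hu2 : ∀ z : ℤ, Integrable (fun p => u (tau z p)) μ := fun z =>
    (mp_tau hμ z).integrable_comp_of_integrable hui
  have hint : Integrable (fun p => (n : ℝ) * |u (tau x p) - u (tau y p)|) μ :=
    ((hu2 x).sub (hu2 y)).abs.const_mul (n : ℝ)
  have hadd : Integrable (fun p => |q (tau x p) - f n (tau x p)| + |q (tau y p) - f n (tau y p)|) μ :=
    (hm1 x).add (hm1 y)
  have hle : rhoQ μ Q x y ≤ ∫ p, ((|q (tau x p) - f n (tau x p)| + |q (tau y p) - f n (tau y p)|) +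
      n * |u (tau x p) - u (tau y p)|) ∂μ := by
    refine integral_mono (integrable_of_le
      (((hqm.comp (tau_measurable x)).sub (hqm.comp (tau_measurable y))).abs) 1 fun p => ?_)
      (hadd.add hint) fun p => ?_
    · rw [abs_abs, abs_le]
      constructor <;>
        linarith [(hq01 (tau x p)).1, (hq01 (tau x p)).2, (hq01 (tau y p)).1, (hq01 (tau y p)).2]
    · have hlip : |f n (tau x p) - f n (tau y p)| ≤ n * |u (tau x p) - u (tau y p)| := by
        have a := abs_min_sub_min_le_max 1 (n * max (u (tau x p)) 0) 1 (n * max (u (tau y p)) 0)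
        have b := abs_max_sub_max_le_abs (u (tau x p)) (u (tau y p)) 0
        rw [sub_self, abs_zero, ← mul_sub, abs_mul, Nat.abs_cast,
          max_eq_right (mul_nonneg (Nat.cast_nonneg n) (abs_nonneg _))] at a
        exact a.trans (mul_le_mul_of_nonneg_left b (Nat.cast_nonneg n))
      have e : q (tau x p) - q (tau y p) = (q (tau x p) - f n (tau x p)) -
        (q (tau y p) - f n (tau y p)) + (f n (tau x p) - f n (tau y p)) := by ring
      show |q (tau x p) - q (tau y p)| ≤ _
      rw [e]
      refine (abs_add_le _ _).trans ?_
      have := abs_sub (q (tau x p) - f n (tau x p)) (q (tau y p) - f n (tau y p))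
      beta_reduce
      linarith
  rw [integral_add hadd hint, integral_add (hm1 x) (hm1 y),
    integral_const_mul, integral_tau hμ x (f := fun p => |q p - f n p|) (hqm.sub (hfm n)).abs,
    integral_tau hμ y (f := fun p => |q p - f n p|) (hqm.sub (hfm n)).abs] at hle
  have h3 : (n : ℝ) * ∫ p, |u (tau x p) - u (tau y p)| ∂μ ≤ ε / 2 := by
    have a : (n : ℝ) * ∫ p, |u (tau x p) - u (tau y p)| ∂μ ≤ (n + 1) * (ε / (2 * (n + 1))) :=
      mul_le_mul (by linarith) hxy' (integral_nonneg fun _ => abs_nonneg _) (by positivity)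
    have b : ((n : ℝ) + 1) * (ε / (2 * (n + 1))) = ε / 2 := by field_simp
    linarith
  linarith

lemma exists_Q (hμ : MeasurePreserving (tau 1) μ μ) (ℓ m : ℕ) (hm : 0 < m) (A : Set ℤ) {S : Set Om}
    (hS : MeasurableSet S) (hb : Bad μ ℓ m A S) :
    ∃ Q : Set Om, MeasurableSet Q ∧ μ (S ∩ Q) = 0 ∧ ∫ p in S, ext (wS μ ℓ m A Qᶜ) p ∂μ = 0 ∧
      TB (rhoQ μ Q) := by
  obtain ⟨u, hu⟩ := exists_u (μ := μ) ℓ m A S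
  have hum := (Lp.stronglyMeasurable u).measurable
  have hui : Integrable u μ := (Lp.memLp u).integrable (by norm_num)
  have hE : ∀ E : Set Om, MeasurableSet E →
      ∫ p in E, u p ∂μ = ∫ p in S, ext (wS μ ℓ m A E) p ∂μ := by
    intro E hE
    have h1 := hu (indicatorConstLp 2 hE (measure_ne_top μ _) (1 : ℝ))
    simp only [al_inner] at h1
    rw [real_inner_comm, L2.inner_indicatorConstLp_one] at h1
    exact h1
  have hpos : 0 ≤ᵐ[μ] u := by
    refine ae_nonneg_of_forall_setIntegral_nonneg hui fun E hEm _ => ?_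
    rw [hE E hEm]
    exact integral_nonneg fun p => le_ext (wS_bdd _ _ _ _) fun _ => measureReal_nonneg
  have hQm : MeasurableSet {p | 0 < u p} := measurableSet_lt measurable_const hum
  refine ⟨{p | 0 < u p}, hQm, ?_, ?_, tb_Q hμ hum hui (tb_u hμ ℓ m hm A S u hu)⟩
  · have h0 : ∫ p in S, u p ∂μ = 0 := by rw [hE S hS]; exact hb
    rw [setIntegral_eq_zero_iff_of_nonneg_ae (ae_restrict_of_ae hpos) hui.integrableOn] at h0
    rw [EventuallyEq, ae_restrict_iff' hS] at h0
    rw [measure_eq_zero_iff_ae_notMem]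
    filter_upwards [h0] with p hp hpm
    have := hp hpm.1
    have h2 : 0 < u p := hpm.2
    simp only [Pi.zero_apply] at this
    linarith
  · rw [← hE _ hQm.compl]
    rw [setIntegral_congr_ae (g := fun _ => (0 : ℝ)) hQm.compl, integral_zero]
    filter_upwards [hpos] with p hp hpm
    have : ¬ 0 < u p := hpm
    exact le_antisymm (not_lt.1 this) hp

end
end SumsetAux

namespace SumsetAux

variable {μ : Measure Om}

/-- totally bounded translation-invariant pseudometric on the integers -/
structure APM (ρ : ℤ → ℤ → ℝ) : Prop where
  nonneg : ∀ x y, 0 ≤ ρ x y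
  symm : ∀ x y, ρ x y = ρ y x
  tri : ∀ x y z, ρ x z ≤ ρ x y + ρ y z
  inv : ∀ x y h, ρ (x + h) (y + h) = ρ x y
  tb : TB ρ

noncomputable def kap (ρ : ℤ → ℤ → ℝ) (ε : ℝ) (x y : ℤ) : ℝ := max 0 (1 - ρ x y / ε)

section kap
variable {ρ : ℤ → ℤ → ℝ} (hρ : APM ρ) {ε : ℝ} (hε : 0 < ε)
include hρ hε

lemma kap_nonneg (x y : ℤ) : 0 ≤ kap ρ ε x y := le_max_left _ _

lemma kap_le_one (x y : ℤ) : kap ρ ε x y ≤ 1 :=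
  max_le zero_le_one (by have := div_nonneg (hρ.nonneg x y) hε.le; linarith)

lemma kap_bdd (x : ℤ) : Bdd (kap ρ ε x) := Bdd.of01 (kap_nonneg hρ hε x) (kap_le_one hρ hε x)

lemma kap_symm (x y : ℤ) : kap ρ ε x y = kap ρ ε y x := by unfold kap; rw [hρ.symm]

lemma kap_inv (x y h : ℤ) : kap ρ ε (x + h) (y + h) = kap ρ ε x y := by unfold kap; rw [hρ.inv]

lemma kap_eq (x y : ℤ) : kap ρ ε x y = kap ρ ε 0 (y - x) := by
  have := kap_inv hρ hε 0 (y - x) x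
  rw [← this]; congr 1 <;> ring

lemma kap_neg (x : ℤ) : kap ρ ε 0 (-x) = kap ρ ε 0 x := by
  rw [kap_symm hρ hε, kap_eq hρ hε]; congr 1; ring

lemma kap_lip (x y z : ℤ) : |kap ρ ε x y - kap ρ ε z y| ≤ ρ x z / ε := by
  unfold kap
  have h1 := abs_max_sub_max_le_max 0 (1 - ρ x y / ε) 0 (1 - ρ z y / ε)
  rw [sub_self, abs_zero, max_eq_right (abs_nonneg (1 - ρ x y / ε - (1 - ρ z y / ε)))] at h1
  refine h1.trans ?_
  rw [show 1 - ρ x y / ε - (1 - ρ z y / ε) = (ρ z y - ρ x y) / ε by ring, abs_div, abs_of_pos hε]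
  gcongr
  rw [abs_le]
  constructor
  · linarith [hρ.tri x z y]
  · linarith [hρ.tri z x y, hρ.symm x z]

lemma kap_mul_rho (x y : ℤ) : ρ x y * kap ρ ε x y ≤ ε * kap ρ ε x y := by
  by_cases h : ρ x y ≤ ε
  · exact mul_le_mul_of_nonneg_right h (kap_nonneg hρ hε x y)
  · have : kap ρ ε x y = 0 := by
      unfold kap
      refine max_eq_left ?_
      have : 1 ≤ ρ x y / ε := by rw [le_div_iff₀ hε]; linarith
      linarith
    rw [this]; simp

variable [IsProbabilityMeasure μ]

lemma kap_mean (hμ : MeasurePreserving (tau 1) μ μ) (x : ℤ) :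
    L μ (kap ρ ε x) = L μ (kap ρ ε 0) := by
  rw [← L_shift hμ (kap_bdd hρ hε 0) (-x)]
  congr 1
  funext y
  rw [kap_eq hρ hε, sub_eq_add_neg]

lemma kap_mean_pos (hμ : MeasurePreserving (tau 1) μ μ) : 0 < L μ (kap ρ ε 0) := by
  obtain ⟨r, hrf, hr⟩ := hρ.tb.rep (half_pos hε)
  have h1 : ∑ i ∈ hrf.toFinset, L μ (ind {x | r x = i}) = 1 := by
    rw [← L_sum _ fun i _ => ind_bdd _]
    rw [← L_const (μ := μ) 1]
    congr 1
    funext x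
    rw [Finset.sum_eq_single (r x)]
    · simp [ind]
    · intro b _ hb
      simp [ind, Ne.symm hb]
    · intro h; exact absurd (by simp) h
  obtain ⟨i, -, hi⟩ := Finset.exists_ne_zero_of_sum_ne_zero (h1.trans_ne one_ne_zero)
  have hi0 : 0 < L μ (ind {x | r x = i}) :=
    lt_of_le_of_ne (L_nonneg (ind_bdd _) (ind_nonneg _)) (Ne.symm hi)
  rw [← kap_mean hρ hε hμ i]
  have h2 : L μ (fun x => (1 / 2 : ℝ) * ind {x | r x = i} x) ≤ L μ (kap ρ ε i) := by
    refine L_mono ((ind_bdd _).const_mul _) (kap_bdd hρ hε i) fun x => ?_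
    by_cases hx : r x = i
    · have : ind {x | r x = i} x = 1 := by simp [ind, hx]
      rw [this]
      have h3 := hr x
      rw [hx, hρ.symm] at h3
      refine le_trans ?_ (le_max_right _ _)
      have : ρ i x / ε ≤ 1 / 2 := by rw [div_le_iff₀ hε]; linarith
      linarith
    · have : ind {x | r x = i} x = 0 := by simp [ind, hx]
      rw [this, mul_zero]
      exact kap_nonneg hρ hε i x
  rw [L_const_mul _ (ind_bdd _)] at h2
  linarith

lemma sum_shift_le (H : ℕ) (a c : ℤ) (R : ℕ) (hc : |c| ≤ R) :
    ∑ j ∈ Finset.range H, kap ρ ε 0 (a + c + j) ≤ ∑ j ∈ Finset.range H, kap ρ ε 0 (a + j) + 2 * R := by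
  have hk := kap_nonneg hρ hε 0
  have hk1 := kap_le_one hρ hε 0
  have hI : ∀ a : ℤ, ∑ j ∈ Finset.range H, kap ρ ε 0 (a + j) =
      ∑ z ∈ Finset.Ico a (a + H), kap ρ ε 0 z := by
    intro a
    refine Finset.sum_bij (fun j _ => a + j) ?_ ?_ ?_ ?_
    · intro j hj; simp only [Finset.mem_range, Finset.mem_Ico] at *; omega
    · intro i _ j _ h; omega
    · intro z hz
      simp only [Finset.mem_Ico] at hz
      exact ⟨(z - a).toNat, by simp only [Finset.mem_range]; omega, by omega⟩
    · intro j _; rfl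
  rw [hI, hI]
  have hsub : Finset.Ico (a + c) (a + c + H) ⊆ Finset.Ico a (a + H) ∪
      (Finset.Ico (a - R) a ∪ Finset.Ico (a + H) (a + H + R)) := by
    intro z hz
    rw [abs_le] at hc
    simp only [Finset.mem_union, Finset.mem_Ico] at *
    omega
  refine (Finset.sum_le_sum_of_subset_of_nonneg hsub fun z _ _ => hk z).trans ?_
  have hun : ∀ s t : Finset ℤ, ∑ z ∈ s ∪ t, kap ρ ε 0 z ≤ ∑ z ∈ s, kap ρ ε 0 z + ∑ z ∈ t, kap ρ ε 0 z := by
    intro s t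
    rw [← Finset.sum_union_inter]
    have := Finset.sum_nonneg (s := s ∩ t) fun z _ => hk z
    linarith
  refine (hun _ _).trans ?_
  have h2 := hun (Finset.Ico (a - R) a) (Finset.Ico (a + H) (a + H + R))
  have h3 := Finset.sum_le_card_nsmul (Finset.Ico (a - R) a) _ 1 fun z _ => hk1 z
  have h4 := Finset.sum_le_card_nsmul (Finset.Ico (a + H) (a + H + R)) _ 1 fun z _ => hk1 z
  simp at h3 h4
  linarith

lemma uniform_mean (hμ : MeasurePreserving (tau 1) μ μ) {η : ℝ} (hη : 0 < η) :
    ∃ N0 : ℕ, ∀ H : ℕ, N0 ≤ H → ∀ a : ℤ,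
      ∑ j ∈ Finset.range H, kap ρ ε 0 (a + j) ≤ H * (L μ (kap ρ ε 0) + η) := by
  obtain ⟨r, hrf, hr⟩ := hρ.tb.rep (ε := ε * (η / 2)) (by positivity)
  obtain ⟨R, hR⟩ : ∃ R : ℕ, ∀ x, |r x| ≤ R := by
    refine ⟨∑ i ∈ hrf.toFinset, i.natAbs, fun x => ?_⟩
    have := Finset.single_le_sum (f := fun i : ℤ => i.natAbs) (fun i _ => Nat.zero_le _)
      (show r x ∈ hrf.toFinset by simp)
    rw [Int.abs_eq_natAbs]
    exact_mod_cast this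
  obtain ⟨N0, hN0⟩ := exists_nat_gt (4 * R / η)
  refine ⟨N0, fun H hH a => ?_⟩
  have key : ∀ a' : ℤ, ∑ j ∈ Finset.range H, kap ρ ε 0 (a + j) ≤
      ∑ j ∈ Finset.range H, kap ρ ε 0 (a' + j) + (H * (η / 2) + 2 * R) := by
    intro a'
    have h1 : ∀ j ∈ Finset.range H, kap ρ ε 0 (a + j) ≤ kap ρ ε 0 (a' + r (a - a') + j) + η / 2 := by
      intro j _
      have h2 := kap_lip hρ hε (a + j) 0 (a' + r (a - a') + j)
      have h3 : ρ (a + j) (a' + r (a - a') + j) = ρ (a - a') (r (a - a')) := by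
        rw [← hρ.inv (a - a') (r (a - a')) (a' + j)]
        congr 1 <;> ring
      rw [h3, kap_symm hρ hε, kap_symm hρ hε _ 0] at h2
      have h4 : ρ (a - a') (r (a - a')) / ε ≤ η / 2 := by
        rw [div_le_iff₀ hε]; linarith [hr (a - a')]
      linarith [(abs_le.1 (h2.trans h4)).2]
    have h2 := Finset.sum_le_sum h1
    rw [Finset.sum_add_distrib] at h2
    simp only [Finset.sum_const, Finset.card_range, nsmul_eq_mul] at h2
    have h3 := sum_shift_le hρ hε H a' (r (a - a')) R (hR _)
    linarith
  have h5 : L μ (fun _ => ∑ j ∈ Finset.range H, kap ρ ε 0 (a + j)) ≤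
      L μ (fun a' => ∑ j ∈ Finset.range H, kap ρ ε 0 (a' + j) + (H * (η / 2) + 2 * R)) :=
    L_mono (Bdd.const _) ((Bdd.sum _ fun j _ => (kap_bdd hρ hε 0).comp _).add (Bdd.const _)) key
  rw [L_const, L_add (Bdd.sum _ fun j _ => (kap_bdd hρ hε 0).comp _) (Bdd.const _), L_const,
    L_sum _ fun j _ => (kap_bdd hρ hε 0).comp _] at h5
  simp only [L_shift hμ (kap_bdd hρ hε 0)] at h5
  simp only [Finset.sum_const, Finset.card_range, nsmul_eq_mul] at h5
  have h6 : (N0 : ℝ) ≤ H := by exact_mod_cast hH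
  rw [div_lt_iff₀ hη] at hN0
  nlinarith

end kap

section
variable [IsProbabilityMeasure μ]

lemma prod_avg (hμ : Ergodic (tau 1) μ) {f q : Om → ℝ} (hf : Measurable f) (hq : Measurable q)
    (hf1 : ∀ p, |f p| ≤ 1) (hq1 : ∀ p, |q p| ≤ 1) :
    Tendsto (fun N : ℕ => ((N : ℝ)⁻¹) ^ 2 * ∑ s ∈ Finset.range N, ∑ t ∈ Finset.range N,
      ∫ p, f (tau s p) * q (tau t p) ∂μ) atTop (𝓝 ((∫ p, f p ∂μ) * ∫ p, q p ∂μ)) := by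
  have hmp := hμ.toMeasurePreserving
  have h1 := met hμ hf hf1
  set c := ∫ p, f p ∂μ with hc
  rw [tendsto_iff_dist_tendsto_zero]
  have hle : ∀ᶠ N : ℕ in atTop, dist (((N : ℝ)⁻¹) ^ 2 * ∑ s ∈ Finset.range N, ∑ t ∈ Finset.range N,
      ∫ p, f (tau s p) * q (tau t p) ∂μ) (c * ∫ p, q p ∂μ) ≤
      ∫ p, |(N : ℝ)⁻¹ * ∑ s ∈ Finset.range N, f (tau s p) - c| ∂μ := by
    filter_upwards [eventually_gt_atTop 0] with N hN
    have hN' : (N : ℝ) ≠ 0 := by exact_mod_cast hN.ne'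
    set a : Om → ℝ := fun p => (N : ℝ)⁻¹ * ∑ s ∈ Finset.range N, f (tau s p) with ha
    set b : Om → ℝ := fun p => (N : ℝ)⁻¹ * ∑ s ∈ Finset.range N, q (tau s p) with hb
    have ham : Measurable a := (Finset.measurable_sum _ fun s _ => hf.comp (tau_measurable _)).const_mul _
    have hbm : Measurable b := (Finset.measurable_sum _ fun s _ => hq.comp (tau_measurable _)).const_mul _
    have hav : ∀ g : Om → ℝ, (∀ p, |g p| ≤ 1) → ∀ p,
        |(N : ℝ)⁻¹ * ∑ s ∈ Finset.range N, g (tau s p)| ≤ 1 := by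
      intro g hg p
      rw [abs_mul, abs_inv, Nat.abs_cast, inv_mul_le_iff₀ (by exact_mod_cast hN)]
      refine (Finset.abs_sum_le_sum_abs _ _).trans ?_
      refine (Finset.sum_le_card_nsmul _ _ 1 fun s _ => hg _).trans ?_
      simp
    have ha1 := hav f hf1
    have hb1 := hav q hq1
    have hai : Integrable a μ := integrable_of_le ham 1 ha1
    have hbi : Integrable b μ := integrable_of_le hbm 1 hb1
    have habi : Integrable (fun p => a p * b p) μ := integrable_of_le (ham.mul hbm) 1 fun p => by
      rw [abs_mul]; exact mul_le_one₀ (ha1 p) (abs_nonneg _) (hb1 p)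
    have hqi : ∀ s : ℕ, Integrable (fun p => q (tau s p)) μ := fun s =>
      integrable_of_le (hq.comp (tau_measurable s)) 1 fun p => hq1 _
    have hbint : ∫ p, b p ∂μ = ∫ p, q p ∂μ := by
      simp only [hb]
      rw [integral_const_mul, integral_finsetSum _ fun s _ => hqi s]
      simp only [integral_tau hmp _ hq]
      simp [hN']
    have hprod : ((N : ℝ)⁻¹) ^ 2 * ∑ s ∈ Finset.range N, ∑ t ∈ Finset.range N,
        ∫ p, f (tau s p) * q (tau t p) ∂μ = ∫ p, a p * b p ∂μ := by
      have hfq : ∀ s t : ℕ, Integrable (fun p => f (tau s p) * q (tau t p)) μ := fun s t =>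
        integrable_of_le ((hf.comp (tau_measurable s)).mul (hq.comp (tau_measurable t))) 1 fun p => by
          rw [abs_mul]; exact mul_le_one₀ (hf1 _) (abs_nonneg _) (hq1 _)
      have : ∀ p, a p * b p = ((N : ℝ)⁻¹) ^ 2 * ∑ s ∈ Finset.range N, ∑ t ∈ Finset.range N,
          f (tau s p) * q (tau t p) := by
        intro p
        simp only [ha, hb]
        rw [← Finset.sum_mul_sum]; ring
      simp only [this]
      rw [integral_const_mul, integral_finsetSum _ fun s _ => integrable_finsetSum _ fun t _ => hfq s t]
      congr 1
      refine Finset.sum_congr rfl fun s _ => ?_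
      rw [integral_finsetSum _ fun t _ => hfq s t]
    rw [hprod, ← hbint, ← integral_const_mul, Real.dist_eq, ← integral_sub habi (hbi.const_mul c)]
    refine abs_integral_le_integral_abs.trans ?_
    refine integral_mono (habi.sub (hbi.const_mul c)).abs (hai.sub (integrable_const c)).abs fun p => ?_
    show |a p * b p - c * b p| ≤ |a p - c|
    rw [← sub_mul, abs_mul]
    exact mul_le_of_le_one_right (abs_nonneg _) (hb1 p)
  exact squeeze_zero' (Eventually.of_forall fun _ => dist_nonneg) hle h1

end
end SumsetAux

namespace SumsetAux

variable {μ : Measure Om}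

noncomputable def one (S : Set Om) (p : Om) : ℝ := S.indicator (fun _ => (1 : ℝ)) p

lemma one_nonneg (S : Set Om) (p : Om) : 0 ≤ one S p := Set.indicator_nonneg (fun _ _ => zero_le_one) _
lemma one_le_one (S : Set Om) (p : Om) : one S p ≤ 1 := by
  unfold one; by_cases h : p ∈ S <;> simp [h]
lemma one_abs (S : Set Om) (p : Om) : |one S p| ≤ 1 := by
  rw [abs_of_nonneg (one_nonneg S p)]; exact one_le_one S p
lemma one_measurable {S : Set Om} (hS : MeasurableSet S) : Measurable (one S) :=
  measurable_const.indicator hS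
lemma setInt_eq {S : Set Om} (hS : MeasurableSet S) (f : Om → ℝ) :
    ∫ p in S, f p ∂μ = ∫ p, one S p * f p ∂μ := by
  rw [← integral_indicator hS]
  congr 1
  funext p
  unfold one
  by_cases h : p ∈ S <;> simp [h]

section
variable [IsProbabilityMeasure μ]

lemma one_mul_integrable {S : Set Om} (hS : MeasurableSet S) {F : ℤ → ℝ} (hF : Bdd F) :
    Integrable (fun p => one S p * ext F p) μ := by
  obtain ⟨C, hC⟩ := hF
  refine integrable_of_le ((one_measurable hS).mul (ext_measurable ⟨C, hC⟩)) C fun p => ?_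
  rw [abs_mul]
  exact (mul_le_of_le_one_left (abs_nonneg _) (one_abs S p)).trans (ext_abs_le hC)

lemma one_cross (hμ : MeasurePreserving (tau 1) μ μ) {S Q : Set Om} (hS : MeasurableSet S)
    (hQ : MeasurableSet Q) (h0 : μ (S ∩ Q) = 0) (s t : ℤ) :
    ∫ p, one S (tau s p) * one Q (tau t p) ∂μ ≤ rhoQ μ Q s t := by
  have hae : ∀ᵐ p ∂μ, tau s p ∉ S ∩ Q := by
    have : μ (tau s ⁻¹' (S ∩ Q)) = 0 := by
      rw [(mp_tau hμ s).measure_preimage (hS.inter hQ).nullMeasurableSet, h0]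
    exact measure_eq_zero_iff_ae_notMem.1 this
  unfold rhoQ
  have hm : ∀ {S : Set Om} (s : ℤ), MeasurableSet S → Measurable (fun p => one S (tau s p)) :=
    fun s hS => (one_measurable hS).comp (tau_measurable s)
  refine integral_mono_ae (integrable_of_le ((hm s hS).mul (hm t hQ)) 1 fun p => ?_)
    (integrable_of_le (((hm s hQ).sub (hm t hQ)).abs) 1 fun p => ?_) ?_
  · rw [abs_mul]; exact mul_le_one₀ (one_abs _ _) (abs_nonneg _) (one_abs _ _)
  · show |(|one Q (tau s p) - one Q (tau t p)|)| ≤ 1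
    rw [abs_abs, abs_le]
    have h1 := one_nonneg Q (tau s p)
    have h2 := one_nonneg Q (tau t p)
    have h3 := one_le_one Q (tau s p)
    have h4 := one_le_one Q (tau t p)
    constructor <;> linarith
  · filter_upwards [hae] with p hp
    show one S (tau s p) * one Q (tau t p) ≤ |one Q (tau s p) - one Q (tau t p)|
    unfold one
    by_cases h1 : tau s p ∈ S
    · have h2 : tau s p ∉ Q := fun h => hp ⟨h1, h⟩
      by_cases h3 : tau t p ∈ Q <;> simp [h1, h2, h3]
    · simp [h1]

lemma KQ_bdd {ρ : ℤ → ℤ → ℝ} (hρ : APM ρ) {ε : ℝ} (hε : 0 < ε) {Q : Set Om} (hQ : MeasurableSet Q) :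
    Bdd (fun x => ∫ p in Q, ext (kap ρ ε x) p ∂μ) := by
  refine Bdd.of01 (fun x => integral_nonneg fun p => le_ext (kap_bdd hρ hε x) (kap_nonneg hρ hε x))
    fun x => ?_
  rw [setInt_eq hQ]
  have : ∫ p, one Q p * ext (kap ρ ε x) p ∂μ ≤ ∫ p, (1 : ℝ) ∂μ := by
    refine integral_mono (one_mul_integrable hQ (kap_bdd hρ hε x)) (integrable_const _) fun p => ?_
    exact mul_le_one₀ (one_le_one _ _) (le_ext (kap_bdd hρ hε x) (kap_nonneg hρ hε x))
      (ext_le (kap_bdd hρ hε x) (kap_le_one hρ hε x))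
  simpa using this

lemma ergodic_bound (hμ : Ergodic (tau 1) μ) {ρ : ℤ → ℤ → ℝ} (hρ : APM ρ) {ε : ℝ} (hε : 0 < ε)
    {S Q : Set Om} (hS : MeasurableSet S) (hQ : MeasurableSet Q) (h0 : μ (S ∩ Q) = 0)
    (hle : ∀ x y, rhoQ μ Q x y ≤ ρ x y) :
    ∫ p in S, ext (fun x => ∫ q in Q, ext (kap ρ ε x) q ∂μ) p ∂μ ≤ ε * L μ (kap ρ ε 0) := by
  have hmp := hμ.toMeasurePreserving
  have hkb := kap_bdd hρ hε
  have hk0 := kap_nonneg hρ hε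
  have hk1 := kap_le_one hρ hε
  refine le_of_forall_pos_le_add fun δ' hδ' => ?_
  obtain ⟨δ, hδ, hδ2⟩ : ∃ δ : ℝ, 0 < δ ∧ (ε + 2) * δ ≤ δ' :=
    ⟨δ' / (ε + 2), by positivity, by rw [mul_div_cancel₀]; positivity⟩
  obtain ⟨r, hrf, hr⟩ := hρ.tb.rep (ε := ε * δ) (by positivity)
  set I := hrf.toFinset with hI
  have hrI : ∀ x, r x ∈ I := fun x => by simp [hI]
  set J : ℤ → ℤ → ℝ := fun i => ind {x | r x = i} with hJ
  have hJs : ∀ x, ∀ c : ℤ → ℝ, ∑ i ∈ I, J i x * c i = c (r x) := by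
    intro x c
    rw [Finset.sum_eq_single (r x)]
    · simp [hJ, ind]
    · intro b _ hb
      simp [hJ, ind, Ne.symm hb]
    · intro h; exact absurd (hrI x) h
  have hJb : ∀ i, Bdd (J i) := fun i => ind_bdd _
  have hkr : ∀ x y, |kap ρ ε x y - kap ρ ε (r x) y| ≤ δ := fun x y =>
    (kap_lip hρ hε x y (r x)).trans (by rw [div_le_iff₀ hε]; linarith [hr x])
  set f : ℤ → Om → ℝ := fun i p => one S p * ext (J i) p with hf
  set q : ℤ → Om → ℝ := fun i p => one Q p * ext (kap ρ ε i) p with hq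
  have hfm : ∀ i, Measurable (f i) := fun i => (one_measurable hS).mul (ext_measurable (hJb i))
  have hqm : ∀ i, Measurable (q i) := fun i => (one_measurable hQ).mul (ext_measurable (hkb i))
  have hJ1 : ∀ i p, |ext (J i) p| ≤ 1 := fun i p => ext_abs_le fun x => by
    rw [abs_of_nonneg (ind_nonneg _ _)]; exact ind_le_one _ _
  have hk1' : ∀ i p, |ext (kap ρ ε i) p| ≤ 1 := fun i p => ext_abs_le fun x => by
    rw [abs_of_nonneg (hk0 _ _)]; exact hk1 _ _
  have hf1 : ∀ i p, |f i p| ≤ 1 := fun i p => by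
    simp only [hf]; rw [abs_mul]; exact mul_le_one₀ (one_abs _ _) (abs_nonneg _) (hJ1 i p)
  have hq1 : ∀ i p, |q i p| ≤ 1 := fun i p => by
    simp only [hq]; rw [abs_mul]; exact mul_le_one₀ (one_abs _ _) (abs_nonneg _) (hk1' i p)
  have hfi : ∀ i, Integrable (f i) μ := fun i => integrable_of_le (hfm i) 1 (hf1 i)
  have hqi : ∀ i, Integrable (q i) μ := fun i => integrable_of_le (hqm i) 1 (hq1 i)
  -- step 1
  have step1 : ∫ p in S, ext (fun x => ∫ q in Q, ext (kap ρ ε x) q ∂μ) p ∂μ ≤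
      δ + ∑ i ∈ I, (∫ p, f i p ∂μ) * ∫ p, q i p ∂μ := by
    set c : ℤ → ℝ := fun i => ∫ p, q i p ∂μ with hc
    have hK : ∀ x, (fun x => ∫ q in Q, ext (kap ρ ε x) q ∂μ) x ≤ (∑ i ∈ I, c i * J i x) + δ := by
      intro x
      have e1 : ∑ i ∈ I, c i * J i x = c (r x) := by
        rw [← hJs x c]; exact Finset.sum_congr rfl fun i _ => mul_comm _ _
      rw [e1]
      show ∫ q in Q, ext (kap ρ ε x) q ∂μ ≤ _
      rw [setInt_eq hQ]
      have : ∫ p, one Q p * ext (kap ρ ε x) p ∂μ ≤ ∫ p, (q (r x) p + δ) ∂μ := by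
        refine integral_mono (hqi x) ((hqi _).add (integrable_const _)) fun p => ?_
        have h1 : ext (kap ρ ε x) p ≤ ext (kap ρ ε (r x)) p + δ := by
          have := ext_mono (p := p) (hkb x) ((hkb (r x)).add (Bdd.const δ)) fun y => by
            have := (abs_le.1 (hkr x y)).2
            linarith
          rwa [ext_add (hkb _) (Bdd.const _), ext_const] at this
        have h2 := mul_le_mul_of_nonneg_left h1 (one_nonneg Q p)
        have h3 := mul_le_of_le_one_left hδ.le (one_le_one Q p)
        simp only [hq]
        linarith
      rw [integral_add (hqi _) (integrable_const _)] at this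
      simpa using this
    have hsb : Bdd (fun x => ∑ i ∈ I, c i * J i x) := Bdd.sum _ fun i _ => (hJb i).const_mul _
    rw [setInt_eq hS]
    calc ∫ p, one S p * ext (fun x => ∫ q in Q, ext (kap ρ ε x) q ∂μ) p ∂μ
        ≤ ∫ p, ((∑ i ∈ I, c i * f i p) + δ) ∂μ := by
          refine integral_mono (one_mul_integrable hS (KQ_bdd hρ hε hQ))
            ((integrable_finsetSum _ fun i _ => (hfi i).const_mul _).add (integrable_const _)) fun p => ?_
          have h1 := ext_mono (p := p) (KQ_bdd (μ := μ) hρ hε hQ) (hsb.add (Bdd.const δ)) hK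
          rw [ext_add hsb (Bdd.const _), ext_const, ext_sum _ fun i _ => (hJb i).const_mul _] at h1
          simp only [ext_const_mul _ (hJb _)] at h1
          have h2 := mul_le_mul_of_nonneg_left h1 (one_nonneg S p)
          have h3 := mul_le_of_le_one_left hδ.le (one_le_one S p)
          have h4 : one S p * ∑ i ∈ I, c i * ext (J i) p = ∑ i ∈ I, c i * f i p := by
            rw [Finset.mul_sum]
            exact Finset.sum_congr rfl fun i _ => by simp only [hf]; ring
          rw [mul_add, h4] at h2
          linarith
      _ = δ + ∑ i ∈ I, (∫ p, f i p ∂μ) * c i := by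
          rw [integral_add (integrable_finsetSum _ fun i _ => (hfi i).const_mul _) (integrable_const _),
            integral_finsetSum _ fun i _ => (hfi i).const_mul _]
          simp only [integral_const_mul, integral_const, probReal_univ, one_smul]
          rw [add_comm]
          congr 1
          exact Finset.sum_congr rfl fun i _ => mul_comm _ _
  -- step 2
  have hfqi : ∀ i (s t : ℤ), Integrable (fun p => f i (tau s p) * q i (tau t p)) μ := fun i s t =>
    integrable_of_le (((hfm i).comp (tau_measurable s)).mul ((hqm i).comp (tau_measurable t))) 1
      fun p => by rw [abs_mul]; exact mul_le_one₀ (hf1 _ _) (abs_nonneg _) (hq1 _ _)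
  have step2 : ∀ s t : ℤ, ∑ i ∈ I, ∫ p, f i (tau s p) * q i (tau t p) ∂μ ≤ ε * kap ρ ε s t + δ := by
    intro s t
    rw [← integral_finsetSum _ fun i _ => hfqi i s t]
    have hpt : ∀ p, ∑ i ∈ I, f i (tau s p) * q i (tau t p) ≤
        one S (tau s p) * one Q (tau t p) * kap ρ ε s t + δ := by
      intro p
      have e1 : ∑ i ∈ I, f i (tau s p) * q i (tau t p) = one S (tau s p) * one Q (tau t p) *
          ext (fun x => ∑ i ∈ I, J i (x + s) * kap ρ ε i (x + t)) p := by
        rw [ext_sum _ fun i _ => ((hJb i).comp (fun x => x + s)).mul ((hkb i).comp (fun x => x + t)),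
          Finset.mul_sum]
        refine Finset.sum_congr rfl fun i _ => ?_
        rw [ext_mul ((hJb i).comp (fun x => x + s)) ((hkb i).comp (fun x => x + t))]
        simp only [hf, hq, ext_tau (hJb i), ext_tau (hkb i)]
        ring
      rw [e1]
      have h1 : ext (fun x => ∑ i ∈ I, J i (x + s) * kap ρ ε i (x + t)) p ≤ kap ρ ε s t + δ := by
        refine ext_le (Bdd.sum _ fun i _ => ((hJb i).comp (fun x => x + s)).mul
          ((hkb i).comp (fun x => x + t))) fun x => ?_
        rw [hJs (x + s) fun i => kap ρ ε i (x + t)]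
        have h2 := (abs_le.1 (hkr (x + s) (x + t))).1
        have h3 := kap_inv hρ hε s t x
        rw [add_comm s, add_comm t] at h3
        linarith
      have h2 : 0 ≤ one S (tau s p) * one Q (tau t p) := mul_nonneg (one_nonneg _ _) (one_nonneg _ _)
      have h3 : one S (tau s p) * one Q (tau t p) ≤ 1 :=
        mul_le_one₀ (one_le_one _ _) (one_nonneg _ _) (one_le_one _ _)
      nlinarith [mul_le_mul_of_nonneg_left h1 h2]
    have hoi : Integrable (fun p => one S (tau s p) * one Q (tau t p)) μ :=
      integrable_of_le (((one_measurable hS).comp (tau_measurable s)).mul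
        ((one_measurable hQ).comp (tau_measurable t))) 1
        fun p => by rw [abs_mul]; exact mul_le_one₀ (one_abs _ _) (abs_nonneg _) (one_abs _ _)
    have h1 := integral_mono (integrable_finsetSum _ fun i _ => hfqi i s t)
      ((hoi.mul_const (kap ρ ε s t)).add (integrable_const δ)) hpt
    refine h1.trans ?_
    simp only [Pi.add_apply]
    rw [integral_add (hoi.mul_const _) (integrable_const _), integral_mul_const]
    have h2 := mul_le_mul_of_nonneg_right ((one_cross hmp hS hQ h0 s t).trans (hle s t)) (hk0 s t)
    have h3 := kap_mul_rho hρ hε s t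
    simp only [integral_const, probReal_univ, one_smul]
    linarith
  -- step 3
  have step3 : ∑ i ∈ I, (∫ p, f i p ∂μ) * ∫ p, q i p ∂μ ≤ ε * (L μ (kap ρ ε 0) + δ) + δ := by
    have hlim := tendsto_finsetSum I fun i _ => prod_avg hμ (hfm i) (hqm i) (hf1 i) (hq1 i)
    obtain ⟨N0, hN0⟩ := uniform_mean hρ hε hmp hδ
    refine le_of_tendsto hlim ?_
    filter_upwards [eventually_ge_atTop N0, eventually_gt_atTop 0] with N hN hNpos
    have hN' : (0 : ℝ) < N := by exact_mod_cast hNpos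
    rw [← Finset.mul_sum, Finset.sum_comm]
    rw [inv_pow, inv_mul_le_iff₀ (by positivity)]
    calc ∑ s ∈ Finset.range N, ∑ i ∈ I, ∑ t ∈ Finset.range N, ∫ p, f i (tau s p) * q i (tau t p) ∂μ
        ≤ ∑ s ∈ Finset.range N, (ε * (N * (L μ (kap ρ ε 0) + δ)) + N * δ) := by
          refine Finset.sum_le_sum fun s _ => ?_
          rw [Finset.sum_comm]
          refine (Finset.sum_le_sum fun (t : ℕ) _ => step2 s t).trans ?_
          rw [Finset.sum_add_distrib, ← Finset.mul_sum]
          simp only [Finset.sum_const, Finset.card_range, nsmul_eq_mul]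
          have h1 := hN0 N hN (-s)
          have h2 : ∑ t ∈ Finset.range N, kap ρ ε s t = ∑ j ∈ Finset.range N, kap ρ ε 0 (-s + j) :=
            Finset.sum_congr rfl fun t _ => by rw [kap_eq hρ hε]; congr 1; ring
          rw [h2]
          have := mul_le_mul_of_nonneg_left h1 hε.le
          linarith
      _ = N ^ 2 * (ε * (L μ (kap ρ ε 0) + δ) + δ) := by
          simp only [Finset.sum_const, Finset.card_range, nsmul_eq_mul]
          ring
  nlinarith

end
end SumsetAux

namespace SumsetAux

variable {μ : Measure Om}

noncomputable def Lam (μ : Measure Om) (ℓ : ℕ) (D : Set ℤ) : ℝ :=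
  L μ (fun y => ∑ r ∈ Finset.range ℓ, ind D (ℓ * y + r))

section
variable [IsProbabilityMeasure μ]

lemma indc_bdd (D : Set ℤ) (g : ℤ → ℤ) : Bdd (fun y => ind D (g y)) := (ind_bdd D).comp g

lemma Lam_step (hμ : MeasurePreserving (tau 1) μ μ) (ℓ : ℕ) (D : Set ℤ) (z : ℤ) :
    L μ (fun y => ∑ r ∈ Finset.range ℓ, ind D (ℓ * y + r + (z + 1))) =
    L μ (fun y => ∑ r ∈ Finset.range ℓ, ind D (ℓ * y + r + z)) := by
  have hb : ∀ z : ℤ, Bdd (fun y => ∑ r ∈ Finset.range ℓ, ind D (ℓ * y + r + z)) := fun z =>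
    Bdd.sum _ fun r _ => indc_bdd D (fun y => ℓ * y + r + z)
  have h1 : ∀ y : ℤ, (∑ r ∈ Finset.range ℓ, ind D (ℓ * y + r + (z + 1))) + ind D (ℓ * y + z) =
      (∑ r ∈ Finset.range ℓ, ind D (ℓ * y + r + z)) + ind D (ℓ * (y + 1) + z) := by
    intro y
    have h2 := Finset.sum_range_succ (fun r : ℕ => ind D (ℓ * y + r + z)) ℓ
    have h3 := Finset.sum_range_succ' (fun r : ℕ => ind D (ℓ * y + r + z)) ℓ
    rw [h2] at h3
    have e1 : (ℓ : ℤ) * (y + 1) + z = ℓ * y + ℓ + z := by ring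
    rw [e1, h3]
    congr 1
    · refine Finset.sum_congr rfl fun r _ => ?_
      congr 1
      push_cast; ring
    · congr 1; push_cast; ring
  have h2 : L μ (fun y => (∑ r ∈ Finset.range ℓ, ind D (ℓ * y + r + (z + 1))) + ind D (ℓ * y + z)) =
      L μ (fun y => (∑ r ∈ Finset.range ℓ, ind D (ℓ * y + r + z)) + ind D (ℓ * (y + 1) + z)) := by
    congr 1; funext y; exact h1 y
  rw [L_add (hb _) (indc_bdd D fun y => ℓ * y + z), L_add (hb _) (indc_bdd D fun y => ℓ * (y + 1) + z),
    L_shift hμ (indc_bdd D fun y => ℓ * y + z) 1] at h2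
  linarith

lemma Lam_shift (hμ : MeasurePreserving (tau 1) μ μ) (ℓ : ℕ) (D : Set ℤ) (z : ℤ) :
    L μ (fun y => ∑ r ∈ Finset.range ℓ, ind D (ℓ * y + r + z)) = Lam μ ℓ D := by
  induction z using Int.induction_on with
  | zero => simp [Lam]
  | succ i ih => rw [Lam_step hμ, ih]
  | pred i ih =>
    rw [← ih, ← Lam_step hμ]
    simp only [sub_add_cancel]

lemma Lam_nonneg (ℓ : ℕ) (D : Set ℤ) : 0 ≤ Lam μ ℓ D :=
  L_nonneg (Bdd.sum _ fun r _ => indc_bdd D (fun y => ℓ * y + r))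
    fun _ => Finset.sum_nonneg fun _ _ => ind_nonneg _ _

lemma kD_bdd {ρ : ℤ → ℤ → ℝ} (hρ : APM ρ) {ε : ℝ} (hε : 0 < ε) (ℓ m : ℕ) (D : Set ℤ) (x : ℤ) :
    Bdd (fun y => kap ρ ε x y * ind D (m * x + ℓ * y)) :=
  (kap_bdd hρ hε x).mul (indc_bdd D fun y => m * x + ℓ * y)

lemma kDL_bdd {ρ : ℤ → ℤ → ℝ} (hρ : APM ρ) {ε : ℝ} (hε : 0 < ε) (ℓ m : ℕ) (D : Set ℤ) :
    Bdd (fun x => L μ (fun y => kap ρ ε x y * ind D (m * x + ℓ * y))) := by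
  refine Bdd.of01 (fun x => L_nonneg (kD_bdd hρ hε ℓ m D x) fun y =>
    mul_nonneg (kap_nonneg hρ hε x y) (ind_nonneg _ _)) fun x => ?_
  have := L_mono (μ := μ) (kD_bdd hρ hε ℓ m D x) (Bdd.const 1) fun y =>
    mul_le_one₀ (kap_le_one hρ hε x y) (ind_nonneg _ _) (ind_le_one _ _)
  rwa [L_const] at this

lemma upper_bound (hμ : MeasurePreserving (tau 1) μ μ) {ρ : ℤ → ℤ → ℝ} (hρ : APM ρ) {ε : ℝ} (hε : 0 < ε)
    (ℓ m : ℕ) (hℓ : 0 < ℓ) (D : Set ℤ) :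
    ℓ * L μ (fun x => L μ (fun y => kap ρ ε x y * ind D (m * x + ℓ * y))) ≤
      (m + ℓ) * L μ (kap ρ ε 0) * Lam μ ℓ D := by
  have hLam := Lam_nonneg (μ := μ) ℓ D
  set F : ℤ → ℝ := fun x => L μ (fun y => kap ρ ε x y * ind D (m * x + ℓ * y)) with hF
  have hFb : Bdd F := kDL_bdd hρ hε ℓ m D
  have hk0 := kap_nonneg hρ hε 0
  have main : ∀ η : ℝ, 0 < η → ℓ * L μ F ≤ (m + ℓ) * (L μ (kap ρ ε 0) + η) * Lam μ ℓ D := by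
    intro η hη
    obtain ⟨N0, hN0⟩ := uniform_mean hρ hε hμ hη
    set n' := N0 + 1 with hn'
    set n := ℓ * n' with hn
    set H := (m + ℓ) * n' with hH
    have hHN : N0 ≤ H := by rw [hH]; nlinarith
    have hx : ∀ x0 : ℤ, ∑ j ∈ Finset.range n, F (x0 + j) ≤ H * (L μ (kap ρ ε 0) + η) * Lam μ ℓ D := by
      intro x0
      let e : ℕ → ℕ × ℕ := fun j => (((m + ℓ) * j) % ℓ, ((m + ℓ) * j) / ℓ)
      let g : ℕ × ℕ → ℤ → ℝ := fun a y => kap ρ ε 0 (x0 - y + a.2) * ind D (ℓ * y + a.1 + m * x0)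
      have hgb : ∀ a, Bdd (g a) := fun a => ((kap_bdd hρ hε 0).comp fun y => x0 - y + a.2).mul
        (indc_bdd D fun y => ℓ * y + a.1 + m * x0)
      have hFe : ∀ j : ℕ, F (x0 + j) = L μ (g (e j)) := by
        intro j
        simp only [hF]
        rw [← L_shift hμ (kD_bdd hρ hε ℓ m D (x0 + j)) (j - (((m + ℓ) * j / ℓ : ℕ) : ℤ))]
        congr 1
        funext y
        simp only [g, e]
        congr 1
        · rw [kap_eq hρ hε, ← kap_neg hρ hε]
          congr 1; ring
        · congr 1
          have h1 : ((((m + ℓ) * j) % ℓ : ℕ) : ℤ) + ℓ * ((((m + ℓ) * j) / ℓ : ℕ) : ℤ) = (m + ℓ) * j := by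
            exact_mod_cast Nat.mod_add_div ((m + ℓ) * j) ℓ
          linear_combination (-1 : ℤ) * h1
      have hinj : Function.Injective e := by
        intro i j hij
        simp only [e, Prod.mk.injEq] at hij
        have h1 := Nat.mod_add_div ((m + ℓ) * i) ℓ
        rw [hij.1, hij.2, Nat.mod_add_div] at h1
        exact (Nat.eq_of_mul_eq_mul_left (by omega) h1).symm
      have hsub : (Finset.range n).image e ⊆ Finset.range ℓ ×ˢ Finset.range H := by
        intro a ha
        obtain ⟨j, hj, rfl⟩ := Finset.mem_image.1 ha
        simp only [Finset.mem_product, Finset.mem_range, e] at *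
        refine ⟨Nat.mod_lt _ hℓ, ?_⟩
        rw [Nat.div_lt_iff_lt_mul hℓ]
        calc (m + ℓ) * j < (m + ℓ) * n := Nat.mul_lt_mul_of_pos_left hj (by omega)
          _ = H * ℓ := by rw [hn, hH]; ring
      simp only [hFe]
      rw [← L_sum _ fun j _ => hgb (e j)]
      have hsb : Bdd (fun y => ∑ r ∈ Finset.range ℓ, ind D (ℓ * y + r + m * x0)) :=
        Bdd.sum _ fun r _ => indc_bdd D (fun y => ℓ * y + r + m * x0)
      have hpt : ∀ y, ∑ j ∈ Finset.range n, g (e j) y ≤ (H * (L μ (kap ρ ε 0) + η)) *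
          ∑ r ∈ Finset.range ℓ, ind D (ℓ * y + r + m * x0) := by
        intro y
        rw [← Finset.sum_image (f := fun a => g a y) hinj.injOn]
        refine (Finset.sum_le_sum_of_subset_of_nonneg hsub fun a _ _ =>
          mul_nonneg (hk0 _) (ind_nonneg _ _)).trans ?_
        have h1 := hN0 H hHN (x0 - y)
        have h2 : ∑ a ∈ Finset.range ℓ ×ˢ Finset.range H, g a y =
            (∑ j ∈ Finset.range H, kap ρ ε 0 (x0 - y + j)) *
              ∑ r ∈ Finset.range ℓ, ind D (ℓ * y + r + m * x0) := by
          rw [Finset.sum_product, Finset.sum_mul_sum, Finset.sum_comm]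
        rw [h2]
        exact mul_le_mul_of_nonneg_right h1 (Finset.sum_nonneg fun _ _ => ind_nonneg _ _)
      have := L_mono (μ := μ) (Bdd.sum _ fun j _ => hgb (e j)) (hsb.const_mul _) hpt
      rw [L_const_mul _ hsb, Lam_shift hμ] at this
      exact this
    have h1 := L_mono (μ := μ) (Bdd.sum _ fun (j : ℕ) _ => hFb.comp fun x => x + j) (Bdd.const _) hx
    rw [L_const, L_sum _ fun (j : ℕ) _ => hFb.comp fun x => x + j] at h1
    simp only [L_shift hμ hFb] at h1
    simp only [Finset.sum_const, Finset.card_range, nsmul_eq_mul, hn, hH] at h1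
    push_cast at h1
    have hpos : (0 : ℝ) < n' := by rw [hn']; positivity
    refine le_of_mul_le_mul_left ?_ hpos
    linarith
  refine le_of_forall_pos_le_add fun δ hδ => ?_
  have hc : 0 ≤ ((m : ℝ) + ℓ) * Lam μ ℓ D := by positivity
  have h1 := main (δ / ((m + ℓ) * Lam μ ℓ D + 1)) (by positivity)
  refine h1.trans ?_
  have h2 : δ / ((m + ℓ) * Lam μ ℓ D + 1) * ((m + ℓ) * Lam μ ℓ D) ≤ δ := by
    rw [div_mul_eq_mul_div, div_le_iff₀ (by positivity)]
    nlinarith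
  nlinarith

end
end SumsetAux

namespace SumsetAux

variable {μ : Measure Om}

section
variable [IsProbabilityMeasure μ]

lemma rhoQ_integrable {Q : Set Om} (hQ : MeasurableSet Q) (x y : ℤ) :
    Integrable (fun p => |one Q (tau x p) - one Q (tau y p)|) μ := by
  have hm : ∀ s : ℤ, Measurable (fun p => one Q (tau s p)) :=
    fun s => (one_measurable hQ).comp (tau_measurable s)
  refine integrable_of_le ((hm x).sub (hm y)).abs 1 fun p => ?_
  show |(|one Q (tau x p) - one Q (tau y p)|)| ≤ 1
  rw [abs_abs, abs_le]
  have h1 := one_nonneg Q (tau x p)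
  have h2 := one_nonneg Q (tau y p)
  have h3 := one_le_one Q (tau x p)
  have h4 := one_le_one Q (tau y p)
  constructor <;> linarith

lemma rhoQ_nonneg (Q : Set Om) (x y : ℤ) : 0 ≤ rhoQ μ Q x y := integral_nonneg fun _ => abs_nonneg _

lemma rhoQ_tri {Q : Set Om} (hQ : MeasurableSet Q) (x y z : ℤ) :
    rhoQ μ Q x z ≤ rhoQ μ Q x y + rhoQ μ Q y z := by
  unfold rhoQ
  change ∫ p, |one Q (tau x p) - one Q (tau z p)| ∂μ ≤ ∫ p, |one Q (tau x p) - one Q (tau y p)| ∂μ +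
    ∫ p, |one Q (tau y p) - one Q (tau z p)| ∂μ
  rw [← integral_add (rhoQ_integrable hQ x y) (rhoQ_integrable hQ y z)]
  exact integral_mono (rhoQ_integrable hQ x z) ((rhoQ_integrable hQ x y).add (rhoQ_integrable hQ y z))
    fun p => abs_sub_le _ _ _

lemma rhoQ_inv (hμ : MeasurePreserving (tau 1) μ μ) {Q : Set Om} (hQ : MeasurableSet Q) (x y h : ℤ) :
    rhoQ μ Q (x + h) (y + h) = rhoQ μ Q x y := by
  unfold rhoQ
  change ∫ p, |one Q (tau (x + h) p) - one Q (tau (y + h) p)| ∂μ =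
    ∫ p, |one Q (tau x p) - one Q (tau y p)| ∂μ
  have hm : ∀ s : ℤ, Measurable (fun p => one Q (tau s p)) :=
    fun s => (one_measurable hQ).comp (tau_measurable s)
  rw [← integral_tau hμ h (f := fun p => |one Q (tau x p) - one Q (tau y p)|) ((hm x).sub (hm y)).abs]
  simp only [tau_tau, add_comm]

lemma rhoQ_apm (hμ : MeasurePreserving (tau 1) μ μ) {ι : Type*} (s : Finset ι) {Q : ι → Set Om}
    (hQ : ∀ i ∈ s, MeasurableSet (Q i)) (hT : ∀ i ∈ s, TB (rhoQ μ (Q i))) :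
    APM (fun x y => ∑ i ∈ s, rhoQ μ (Q i) x y) where
  nonneg x y := Finset.sum_nonneg fun i _ => rhoQ_nonneg _ _ _
  symm x y := Finset.sum_congr rfl fun i _ => by unfold rhoQ; simp only [abs_sub_comm]
  tri x y z := by
    rw [← Finset.sum_add_distrib]
    exact Finset.sum_le_sum fun i hi => rhoQ_tri (hQ i hi) x y z
  inv x y h := Finset.sum_congr rfl fun i hi => rhoQ_inv hμ (hQ i hi) x y h
  tb := TB.sum s hT

lemma kA_le {ρ : ℤ → ℤ → ℝ} (hρ : APM ρ) {ε : ℝ} (hε : 0 < ε) (ℓ m : ℕ) (A : Set ℤ) {Q : Set Om}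
    (hQ : MeasurableSet Q) (x : ℤ) :
    L μ (fun y => kap ρ ε x y * ind A (m * x + ℓ * y)) ≤
      (∫ q in Q, ext (kap ρ ε x) q ∂μ) + wS μ ℓ m A Qᶜ x := by
  have e1 : (fun y : ℤ => ind A (m * x + ℓ * y)) = ind (Rset ℓ m A x) := by
    funext y; rfl
  have hwm : MeasurableSet (hat (Rset ℓ m A x) ∩ Qᶜ) := (hat_measurable _).inter hQ.compl
  have e2 : wS μ ℓ m A Qᶜ x = ∫ p, one (hat (Rset ℓ m A x) ∩ Qᶜ) p ∂μ := by
    unfold wS one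
    rw [integral_indicator hwm]; simp
  have hoi : Integrable (one (hat (Rset ℓ m A x) ∩ Qᶜ)) μ :=
    integrable_of_le (one_measurable hwm) 1 (one_abs _)
  rw [e2, setInt_eq hQ, ← integral_add (one_mul_integrable hQ (kap_bdd hρ hε x)) hoi]
  unfold L
  refine integral_mono (ext_integrable (kD_bdd hρ hε ℓ m A x))
    ((one_mul_integrable hQ (kap_bdd hρ hε x)).add hoi) fun p => ?_
  show ext (fun y => kap ρ ε x y * (fun y : ℤ => ind A (m * x + ℓ * y)) y) p ≤ _
  rw [e1, ext_mul (kap_bdd hρ hε x) (ind_bdd _), ext_ind]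
  have h0 : 0 ≤ ext (kap ρ ε x) p := le_ext (kap_bdd hρ hε x) (kap_nonneg hρ hε x)
  have h1 : ext (kap ρ ε x) p ≤ 1 := ext_le (kap_bdd hρ hε x) (kap_le_one hρ hε x)
  show _ ≤ one Q p * ext (kap ρ ε x) p + one (hat (Rset ℓ m A x) ∩ Qᶜ) p
  unfold one
  by_cases ha : p ∈ hat (Rset ℓ m A x) <;> by_cases hb : p ∈ Q <;> simp [ha, hb, h0, h1]

lemma key_claim (hμ : Ergodic (tau 1) μ) (ℓ m : ℕ) (hℓ : 0 < ℓ) (hm : 0 < m) (A : Set ℤ)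
    {ι : Type*} (s : Finset ι) {S : ι → Set Om} (hS : ∀ i, MeasurableSet (S i))
    (hb : ∀ i ∈ s, Bad μ ℓ m A (S i)) (hd : ∀ i ∈ s, ∀ j ∈ s, i ≠ j → Disjoint (S i) (S j)) :
    ℓ * ∑ i ∈ s, μ.real (S i) ≤ (m + ℓ) * Lam μ ℓ Aᶜ := by
  classical
  have hmp := hμ.toMeasurePreserving
  have hex : ∀ i, ∃ Q : Set Om, i ∈ s → MeasurableSet Q ∧ μ (S i ∩ Q) = 0 ∧
      ∫ p in S i, ext (wS μ ℓ m A Qᶜ) p ∂μ = 0 ∧ TB (rhoQ μ Q) := by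
    intro i
    by_cases hi : i ∈ s
    · obtain ⟨Q, hQ⟩ := exists_Q hmp ℓ m hm A (hS i) (hb i hi)
      exact ⟨Q, fun _ => hQ⟩
    · exact ⟨∅, fun h => absurd h hi⟩
  choose Q hQ using hex
  set ρ : ℤ → ℤ → ℝ := fun x y => ∑ i ∈ s, rhoQ μ (Q i) x y with hρd
  have hρ : APM ρ := rhoQ_apm hmp s (fun i hi => (hQ i hi).1) (fun i hi => (hQ i hi).2.2.2)
  have hle : ∀ i ∈ s, ∀ x y, rhoQ μ (Q i) x y ≤ ρ x y := fun i hi x y =>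
    Finset.single_le_sum (f := fun i => rhoQ μ (Q i) x y) (fun i _ => rhoQ_nonneg _ _ _) hi
  have main : ∀ ε : ℝ, 0 < ε → ℓ * ∑ i ∈ s, μ.real (S i) ≤ (m + ℓ) * Lam μ ℓ Aᶜ + ℓ * s.card * ε := by
    intro ε hε
    set kb := L μ (kap ρ ε 0) with hkb
    have hkbp : 0 < kb := kap_mean_pos hρ hε hmp
    set G : ℤ → ℝ := fun x => L μ (fun y => kap ρ ε x y * ind A (m * x + ℓ * y)) with hG
    set Gc : ℤ → ℝ := fun x => L μ (fun y => kap ρ ε x y * ind Aᶜ (m * x + ℓ * y)) with hGc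
    have hGb : Bdd G := kDL_bdd hρ hε ℓ m A
    have hGcb : Bdd Gc := kDL_bdd hρ hε ℓ m Aᶜ
    have hsum : ∀ x, G x + Gc x = kb := by
      intro x
      simp only [hG, hGc]
      rw [← L_add (kD_bdd hρ hε ℓ m A x) (kD_bdd hρ hε ℓ m Aᶜ x), hkb, ← kap_mean hρ hε hmp x]
      congr 1
      funext y
      rw [← mul_add]
      by_cases h : (m * x + ℓ * y : ℤ) ∈ A <;> simp [ind, h]
    have hextsum : ∀ p, ext G p + ext Gc p = kb := by
      intro p
      rw [← ext_add hGb hGcb]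
      simp only [hsum]
      exact ext_const _ _
    have hGi : ∀ i ∈ s, ∫ p in S i, ext G p ∂μ ≤ ε * kb := by
      intro i hi
      obtain ⟨hQm, hQ0, hQw, -⟩ := hQ i hi
      have h1 := ergodic_bound hμ hρ hε (hS i) hQm hQ0 (hle i hi)
      have h2 : ∫ p in S i, ext G p ∂μ ≤ ∫ p in S i, (ext (fun x => ∫ q in Q i, ext (kap ρ ε x) q ∂μ) p +
          ext (wS μ ℓ m A (Q i)ᶜ) p) ∂μ := by
        refine setIntegral_mono (ext_integrable hGb).integrableOn
          (((ext_integrable (KQ_bdd hρ hε hQm)).add (ext_integrable (wS_bdd _ _ _ _))).integrableOn)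
          fun p => ?_
        rw [← ext_add (KQ_bdd hρ hε hQm) (wS_bdd _ _ _ _)]
        exact ext_mono hGb ((KQ_bdd hρ hε hQm).add (wS_bdd _ _ _ _)) fun x => kA_le hρ hε ℓ m A hQm x
      rw [integral_add (ext_integrable (KQ_bdd hρ hε hQm)).integrableOn
        (ext_integrable (wS_bdd _ _ _ _)).integrableOn, hQw, add_zero] at h2
      exact h2.trans h1
    have hGci : ∑ i ∈ s, ∫ p in S i, ext Gc p ∂μ ≤ L μ Gc := by
      simp only [setInt_eq (hS _)]
      rw [← integral_finsetSum _ fun i _ => one_mul_integrable (hS i) hGcb]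
      unfold L
      refine integral_mono (integrable_finsetSum _ fun i _ => one_mul_integrable (hS i) hGcb)
        (ext_integrable hGcb) fun p => ?_
      show ∑ i ∈ s, one (S i) p * ext Gc p ≤ ext Gc p
      rw [← Finset.sum_mul]
      have h0 : 0 ≤ ext Gc p := le_ext hGcb fun x => L_nonneg (kD_bdd hρ hε ℓ m Aᶜ x) fun y =>
        mul_nonneg (kap_nonneg hρ hε x y) (ind_nonneg _ _)
      refine mul_le_of_le_one_left h0 ?_
      by_cases hex : ∃ i ∈ s, p ∈ S i
      · obtain ⟨i, hi, hpi⟩ := hex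
        rw [Finset.sum_eq_single_of_mem i hi]
        · exact one_le_one _ _
        · intro j hj hji
          have : p ∉ S j := fun h => Set.disjoint_left.1 (hd j hj i hi hji) h hpi
          simp [one, this]
      · have : ∀ i ∈ s, one (S i) p = 0 := by
          intro i hi
          have : p ∉ S i := fun h => hex ⟨i, hi, h⟩
          simp [one, this]
        rw [Finset.sum_eq_zero this]
        exact zero_le_one
    have hUB := upper_bound hmp hρ hε ℓ m hℓ Aᶜ
    have htot : kb * ∑ i ∈ s, μ.real (S i) = ∑ i ∈ s, ∫ p in S i, ext G p ∂μ + ∑ i ∈ s, ∫ p in S i, ext Gc p ∂μ := by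
      rw [Finset.mul_sum, ← Finset.sum_add_distrib]
      refine Finset.sum_congr rfl fun i _ => ?_
      rw [← integral_add (ext_integrable hGb).integrableOn (ext_integrable hGcb).integrableOn]
      simp only [hextsum]
      simp [mul_comm]
    have h1 := Finset.sum_le_card_nsmul s _ _ hGi
    rw [nsmul_eq_mul] at h1
    have hℓ' : (0 : ℝ) < ℓ := by exact_mod_cast hℓ
    have h2 : kb * ∑ i ∈ s, μ.real (S i) ≤ s.card * (ε * kb) + L μ Gc := by linarith
    have h3 := mul_le_mul_of_nonneg_left h2 hℓ'.le
    refine le_of_mul_le_mul_left ?_ hkbp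
    nlinarith
  refine le_of_forall_pos_le_add fun δ hδ => ?_
  refine (main (δ / (ℓ * s.card + 1)) (by positivity)).trans ?_
  have : (ℓ * s.card : ℝ) * (δ / (ℓ * s.card + 1)) ≤ δ := by
    rw [mul_div_assoc', div_le_iff₀ (by positivity)]
    nlinarith
  linarith

end
end SumsetAux

namespace SumsetAux

variable {μ : Measure Om}

section
variable [IsProbabilityMeasure μ]

lemma bad_nonneg (ℓ m : ℕ) (A : Set ℤ) (S : Set Om) : 0 ≤ ∫ p in S, ext (wS μ ℓ m A S) p ∂μ :=
  integral_nonneg fun _ => le_ext (wS_bdd _ _ _ _) fun _ => measureReal_nonneg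

lemma bad_mono (ℓ m : ℕ) (A : Set ℤ) {S T : Set Om} (hST : T ⊆ S) (hS : Bad μ ℓ m A S) :
    Bad μ ℓ m A T := by
  refine le_antisymm ?_ (bad_nonneg ℓ m A T)
  rw [← show ∫ p in S, ext (wS μ ℓ m A S) p ∂μ = 0 from hS]
  have h1 : ∫ p in T, ext (wS μ ℓ m A T) p ∂μ ≤ ∫ p in T, ext (wS μ ℓ m A S) p ∂μ :=
    integral_mono (ext_integrable (wS_bdd _ _ _ _)).integrableOn
      (ext_integrable (wS_bdd _ _ _ _)).integrableOn fun p => ext_mono (wS_bdd _ _ _ _) (wS_bdd _ _ _ _)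
        fun x => measureReal_mono (Set.inter_subset_inter_right _ hST)
  refine h1.trans (setIntegral_mono_set (ext_integrable (wS_bdd _ _ _ _)).integrableOn ?_ ?_)
  · exact Eventually.of_forall fun p => le_ext (wS_bdd _ _ _ _) fun _ => measureReal_nonneg
  · exact hST.eventuallyLE

lemma bad_iUnion (hμ : Ergodic (tau 1) μ) (ℓ m : ℕ) (hℓ : 0 < ℓ) (hm : 0 < m) (A : Set ℤ)
    {T : ℕ → Set Om} (hT : ∀ i, MeasurableSet (T i)) (hb : ∀ i, Bad μ ℓ m A (T i)) :
    μ.real (⋃ i, T i) ≤ (m + ℓ) * Lam μ ℓ Aᶜ / ℓ := by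
  have hℓ' : (0 : ℝ) < ℓ := by exact_mod_cast hℓ
  have hL := Lam_nonneg (μ := μ) ℓ Aᶜ
  have h0 : 0 ≤ (m + ℓ) * Lam μ ℓ Aᶜ / ℓ := by positivity
  have hdm := MeasurableSet.disjointed hT
  rw [← iUnion_disjointed, measureReal_def,
    measure_iUnion (disjoint_disjointed T) hdm]
  refine ENNReal.toReal_le_of_le_ofReal h0 ?_
  refine ENNReal.tsum_le_of_sum_range_le fun n => ?_
  have h1 := key_claim hμ ℓ m hℓ hm A (Finset.range n) hdm
    (fun i _ => bad_mono ℓ m A (disjointed_subset T i) (hb i))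
    (fun i _ j _ hij => disjoint_disjointed T hij)
  have h2 : ∑ i ∈ Finset.range n, μ (disjointed T i) =
      ENNReal.ofReal (∑ i ∈ Finset.range n, μ.real (disjointed T i)) := by
    rw [ENNReal.ofReal_sum_of_nonneg fun i _ => measureReal_nonneg]
    exact Finset.sum_congr rfl fun i _ => by rw [ofReal_measureReal]
  rw [h2]
  refine ENNReal.ofReal_le_ofReal ?_
  rw [le_div_iff₀ hℓ']
  linarith

lemma exhaust (hμ : Ergodic (tau 1) μ) (ℓ m : ℕ) (hℓ : 0 < ℓ) (hm : 0 < m) (A : Set ℤ) :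
    ∃ W : Set Om, MeasurableSet W ∧ μ.real W ≤ (m + ℓ) * Lam μ ℓ Aᶜ / ℓ ∧
      ∀ S, MeasurableSet S → Bad μ ℓ m A S → Disjoint S W → μ S = 0 := by
  set Wc : Set (Set Om) := {W | ∃ T : ℕ → Set Om, (∀ i, MeasurableSet (T i) ∧ Bad μ ℓ m A (T i)) ∧
    W = ⋃ i, T i} with hWc
  have hbadempty : Bad μ ℓ m A (∅ : Set Om) := by simp [Bad]
  have hne : (∅ : Set Om) ∈ Wc := ⟨fun _ => ∅, fun _ => ⟨MeasurableSet.empty, hbadempty⟩, by simp⟩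
  have hbd : BddAbove (μ.real '' Wc) := ⟨1, by rintro _ ⟨W, -, rfl⟩; exact measureReal_le_one⟩
  set σ := sSup (μ.real '' Wc) with hσ
  have hseq : ∀ n : ℕ, ∃ W ∈ Wc, σ - 1 / (n + 1) < μ.real W := by
    intro n
    obtain ⟨_, ⟨W, hW, rfl⟩, h⟩ := exists_lt_of_lt_csSup (s := μ.real '' Wc) ⟨_, _, hne, rfl⟩
      (show σ - 1 / (n + 1) < σ by have : (0 : ℝ) < 1 / (n + 1) := by positivity
                                   linarith)
    exact ⟨W, hW, h⟩
  choose V hV hVσ using hseq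
  choose T hT hVT using hV
  have hT'b : ∀ i, MeasurableSet (T (Nat.unpair i).1 (Nat.unpair i).2) ∧
    Bad μ ℓ m A (T (Nat.unpair i).1 (Nat.unpair i).2) := fun i => hT _ _
  set W : Set Om := ⋃ i, T (Nat.unpair i).1 (Nat.unpair i).2 with hW
  have hWm : MeasurableSet W := MeasurableSet.iUnion fun i => (hT'b i).1
  have hVW : ∀ n, V n ⊆ W := by
    intro n
    rw [hVT n, hW, Set.iUnion_unpair]
    exact Set.subset_iUnion (fun i => ⋃ j, T i j) n
  have hWσ : σ ≤ μ.real W := by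
    refine le_of_forall_pos_lt_add fun δ hδ => ?_
    obtain ⟨n, hn⟩ := exists_nat_one_div_lt hδ
    have := measureReal_mono (μ := μ) (hVW n)
    linarith [hVσ n]
  refine ⟨W, hWm, bad_iUnion hμ ℓ m hℓ hm A (fun i => (hT'b i).1) (fun i => (hT'b i).2), ?_⟩
  intro S hS hSb hd
  have hmem : S ∪ W ∈ Wc := by
    refine ⟨fun n => Nat.casesOn n S fun i => T (Nat.unpair i).1 (Nat.unpair i).2, ?_, ?_⟩
    · intro i
      cases i with
      | zero => exact ⟨hS, hSb⟩
      | succ i => exact hT'b i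
    · rw [← Set.union_iUnion_nat_succ]
      rfl
  have h1 : μ.real (S ∪ W) ≤ σ := le_csSup hbd ⟨_, hmem, rfl⟩
  rw [measureReal_union hd hWm] at h1
  have h2 : μ.real S = 0 := le_antisymm (by linarith) measureReal_nonneg
  rwa [measureReal_eq_zero_iff] at h2

def RI (ℓ m : ℕ) (A : Set ℤ) (I : Finset ℤ) : Set ℤ := {x | ∀ b ∈ I, x ∈ Rset ℓ m A b}

def Cset (ℓ m : ℕ) (A : Set ℤ) : Set ℤ := {y | 0 ≤ y ∧ ((m : ℤ) + ℓ) * y ∈ A}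

def PI (ℓ m : ℕ) (A : Set ℤ) (G : Set Om) (I : Finset ℤ) (n : ℤ) : Set Om :=
  G ∩ hat (RI ℓ m A I) ∩ ⋂ b ∈ {b : ℤ | b ∈ RI ℓ m A I ∧ b ∈ Cset ℓ m A ∧ n ≤ b}, (hat (Rset ℓ m A b))ᶜ

lemma PI_bad (hμ : MeasurePreserving (tau 1) μ μ) (ℓ m : ℕ) (A : Set ℤ) {G : Set Om}
    (hG : MeasurableSet G) (hGC : G ⊆ hat (Cset ℓ m A)) (I : Finset ℤ) (n : ℤ) :
    MeasurableSet (PI ℓ m A G I n) ∧ Bad μ ℓ m A (PI ℓ m A G I n) := by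
  have hPm : MeasurableSet (PI ℓ m A G I n) :=
    (hG.inter (hat_measurable _)).inter
      (MeasurableSet.biInter (Set.to_countable _) fun b _ => (hat_measurable _).compl)
  refine ⟨hPm, le_antisymm ?_ (bad_nonneg ℓ m A _)⟩
  set P := PI ℓ m A G I n with hP
  set K : Set ℤ := RI ℓ m A I ∩ Cset ℓ m A with hK
  have hPK : ∀ p ∈ P, p ∈ hat K := by
    intro p hp
    have h1 : RI ℓ m A I ∈ p := hp.1.2
    have h2 : Cset ℓ m A ∈ p := hGC hp.1.1
    exact Filter.inter_mem h1 h2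
  have hw := wS_bdd (μ := μ) ℓ m A P
  rw [setInt_eq hPm]
  have h1 : ∫ p, one P p * ext (wS μ ℓ m A P) p ∂μ ≤ L μ (fun b => ind K b * wS μ ℓ m A P b) := by
    refine integral_mono (one_mul_integrable hPm hw) (ext_integrable ((ind_bdd K).mul hw)) fun p => ?_
    show one P p * ext (wS μ ℓ m A P) p ≤ _
    rw [ext_mul (ind_bdd K) hw, ext_ind]
    have h0 : 0 ≤ ext (wS μ ℓ m A P) p := le_ext hw fun _ => measureReal_nonneg
    refine mul_le_mul_of_nonneg_right ?_ h0
    by_cases h : p ∈ P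
    · simp [one, h, hPK p h]
    · simp only [one, h, not_false_eq_true, Set.indicator_of_notMem]
      exact Set.indicator_nonneg (fun _ _ => zero_le_one) _
  refine h1.trans ?_
  rw [← L_finset hμ (Finset.Ico 0 n)]
  refine L_mono ((ind_bdd K).mul hw) (ind_bdd _) fun b => ?_
  by_cases hb : b ∈ K
  · by_cases hbn : n ≤ b
    · have : hat (Rset ℓ m A b) ∩ P = ∅ := by
        rw [Set.eq_empty_iff_forall_notMem]
        rintro p ⟨hp1, hp2⟩
        have := Set.mem_iInter₂.1 hp2.2 b ⟨hb.1, hb.2, hbn⟩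
        exact this hp1
      have h2 : wS μ ℓ m A P b = 0 := by unfold wS; rw [this]; simp
      rw [h2, mul_zero]
      exact ind_nonneg _ _
    · have hmem : b ∈ ((Finset.Ico 0 n : Finset ℤ) : Set ℤ) := by
        rw [Finset.coe_Ico]
        exact ⟨hb.2.1, not_le.1 hbn⟩
      have h3 : ind ((Finset.Ico 0 n : Finset ℤ) : Set ℤ) b = 1 := by
        unfold ind; rw [Set.indicator_of_mem hmem]; rfl
      rw [h3]
      exact mul_le_one₀ (ind_le_one _ _) measureReal_nonneg measureReal_le_one
  · have h3 : ind K b = 0 := by unfold ind; rw [Set.indicator_of_notMem hb]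
    rw [h3, zero_mul]
    exact ind_nonneg _ _

lemma construct (hμ : Ergodic (tau 1) μ) (ℓ m : ℕ) (hℓ : 0 < ℓ) (hm : 0 < m) (A : Set ℤ)
    (h : (m + ℓ) * Lam μ ℓ Aᶜ / ℓ < μ.real (hat (Cset ℓ m A))) :
    ∃ b : ℕ → ℤ, (∀ n, b n ∈ Cset ℓ m A) ∧ ∀ i j, i < j → b i < b j ∧ b j ∈ Rset ℓ m A (b i) := by
  have hmp := hμ.toMeasurePreserving
  obtain ⟨W, hWm, hWle, hW⟩ := exhaust hμ ℓ m hℓ hm A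
  set G : Set Om := hat (Cset ℓ m A) \ W with hG
  have hGm : MeasurableSet G := (hat_measurable _).diff hWm
  have hGC : G ⊆ hat (Cset ℓ m A) := Set.sdiff_subset
  have hGpos : μ G ≠ 0 := by
    intro h0
    have h1 : μ.real (hat (Cset ℓ m A)) ≤ μ.real (G ∪ W) :=
      measureReal_mono (by rw [hG, Set.sdiff_union_self]; exact Set.subset_union_left)
    have h2 := measureReal_union_le (μ := μ) G W
    have h3 : μ.real G = 0 := by rw [measureReal_def, h0]; rfl
    linarith
  have hnull : μ (⋃ a : Finset ℤ × ℤ, PI ℓ m A G a.1 a.2) = 0 := by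
    rw [measure_iUnion_null_iff]
    intro a
    obtain ⟨h1, h2⟩ := PI_bad hmp ℓ m A hGm hGC a.1 a.2
    refine hW _ h1 h2 ?_
    rw [Set.disjoint_left]
    intro p hp hpW
    exact hp.1.1.2 hpW
  obtain ⟨p, hpG, hp⟩ : ∃ p ∈ G, p ∉ ⋃ a : Finset ℤ × ℤ, PI ℓ m A G a.1 a.2 := by
    by_contra hcon
    push Not at hcon
    exact hGpos (measure_mono_null hcon hnull)
  have hstep : ∀ s : Finset ℤ, (∀ x ∈ s, x ∈ Cset ℓ m A ∧ Rset ℓ m A x ∈ p) →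
      ∃ y, (y ∈ Cset ℓ m A ∧ Rset ℓ m A y ∈ p) ∧ ∀ x ∈ s, x < y ∧ y ∈ Rset ℓ m A x := by
    intro s hs
    have hRI : RI ℓ m A s ∈ p := by
      have : RI ℓ m A s = ⋂ b ∈ s, Rset ℓ m A b := by
        apply Set.ext; intro x; simp [RI]
      rw [this]
      exact (Filter.biInter_finset_mem s).2 fun b hb => (hs b hb).2
    obtain ⟨n, hn⟩ : ∃ n : ℤ, ∀ x ∈ s, x < n := by
      obtain ⟨M, hM⟩ := s.bddAbove
      exact ⟨M + 1, fun x hx => by have := hM hx; omega⟩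
    by_contra hcon
    push Not at hcon
    refine hp (Set.mem_iUnion.2 ⟨(s, n), ⟨hpG, hRI⟩, ?_⟩)
    refine Set.mem_iInter₂.2 fun b hb hbp => ?_
    obtain ⟨x, hx, hx2⟩ := hcon b ⟨hb.2.1, hbp⟩
    exact hx2 (lt_of_lt_of_le (hn x hx) hb.2.2) (hb.1 x hx)
  obtain ⟨f, hf1, hf2⟩ := exists_seq_of_forall_finset_exists _ _ hstep
  exact ⟨f, fun n => (hf1 n).1, hf2⟩

end
end SumsetAux

namespace SumsetAux

variable {μ : Measure Om}

/-- a set of naturals seen as a set of integers -/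
def AZ (A : Set ℕ) : Set ℤ := {z | 0 ≤ z ∧ z.toNat ∈ A}

lemma mem_AZ (A : Set ℕ) (n : ℕ) : (n : ℤ) ∈ AZ A ↔ n ∈ A := by simp [AZ]

lemma sum_block (ℓ M : ℕ) (f : ℕ → ℝ) :
    ∑ y ∈ Finset.range M, ∑ r ∈ Finset.range ℓ, f (ℓ * y + r) = ∑ x ∈ Finset.range (ℓ * M), f x := by
  induction M with
  | zero => simp
  | succ M ih => rw [Finset.sum_range_succ, ih, Nat.mul_succ, Finset.sum_range_add]

noncomputable def dcount (A : Set ℕ) (K : ℕ) : ℝ := ∑ x ∈ Finset.range K, ind (AZ A)ᶜ (x : ℤ)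

lemma dcount_mono (A : Set ℕ) {K K' : ℕ} (h : K ≤ K') : dcount A K ≤ dcount A K' :=
  Finset.sum_le_sum_of_subset_of_nonneg (Finset.range_mono h) fun _ _ _ => ind_nonneg _ _

open scoped Classical in
lemma dcount_le (A : Set ℕ) (N : ℕ) :
    dcount A (N + 1) ≤ 1 + (N - (((Finset.Icc 1 N).filter (· ∈ A)).card : ℝ)) := by
  unfold dcount
  have h1 : Finset.range (N + 1) = insert 0 (Finset.Icc 1 N) := by
    ext x; simp only [Finset.mem_range, Finset.mem_insert, Finset.mem_Icc]; omega
  rw [h1, Finset.sum_insert (by simp)]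
  refine add_le_add (ind_le_one _ _) ?_
  have h2 : ∑ x ∈ Finset.Icc 1 N, ind (AZ A)ᶜ (x : ℤ) =
      ∑ x ∈ Finset.Icc 1 N, (1 - if x ∈ A then (1 : ℝ) else 0) := by
    refine Finset.sum_congr rfl fun x _ => ?_
    have := mem_AZ A x
    by_cases hx : x ∈ A <;> simp [ind, Set.indicator_apply, this, hx]
  rw [h2, Finset.sum_sub_distrib, Finset.sum_boole]
  simp

lemma Csum (A : Set ℕ) (ℓ m : ℕ) (hℓ : 0 < ℓ) (M N : ℕ) (h : (m + ℓ) * M ≤ N) :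
    M - dcount A (N + 1) ≤ ∑ y ∈ Finset.range M, ind (Cset ℓ m (AZ A)) (y : ℤ) := by
  have h1 : ∀ y : ℕ, ind (Cset ℓ m (AZ A)) (y : ℤ) = 1 - ind (AZ A)ᶜ (((m + ℓ) * y : ℕ) : ℤ) := by
    intro y
    have h2 : (y : ℤ) ∈ Cset ℓ m (AZ A) ↔ (((m + ℓ) * y : ℕ) : ℤ) ∈ AZ A := by
      unfold Cset
      constructor
      · rintro ⟨-, h⟩; push_cast; exact h
      · intro h; refine ⟨Int.natCast_nonneg y, ?_⟩; push_cast at h; exact h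
    by_cases h3 : (((m + ℓ) * y : ℕ) : ℤ) ∈ AZ A
    · rw [ind, ind, Set.indicator_of_mem (h2.2 h3), Set.indicator_of_notMem (by simpa using h3)]; simp
    · rw [ind, ind, Set.indicator_of_notMem (fun h => h3 (h2.1 h)), Set.indicator_of_mem (by simpa using h3)]
      simp
  simp only [h1]
  rw [Finset.sum_sub_distrib]
  simp only [Finset.sum_const, Finset.card_range, nsmul_eq_mul, mul_one]
  have hinj : Set.InjOn (fun y : ℕ => (m + ℓ) * y) (Finset.range M : Set ℕ) := fun a _ b _ hab =>
    Nat.eq_of_mul_eq_mul_left (by omega) hab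
  have h4 : ∑ y ∈ Finset.range M, ind (AZ A)ᶜ (((m + ℓ) * y : ℕ) : ℤ) ≤ dcount A (N + 1) := by
    unfold dcount
    rw [← Finset.sum_image (f := fun x : ℕ => ind (AZ A)ᶜ (x : ℤ)) hinj]
    refine Finset.sum_le_sum_of_subset_of_nonneg ?_ fun _ _ _ => ind_nonneg _ _
    intro x hx
    obtain ⟨y, hy, rfl⟩ := Finset.mem_image.1 hx
    rw [Finset.mem_range] at *
    have : (m + ℓ) * y ≤ (m + ℓ) * M := Nat.mul_le_mul_left _ hy.le
    show (m + ℓ) * y < N + 1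
    omega
  linarith

noncomputable def psi (ℓ m : ℕ) (A : Set ℤ) (y : ℤ) : ℝ :=
  ind (Cset ℓ m A) y - ((m + ℓ : ℝ) / ℓ) * ∑ r ∈ Finset.range ℓ, ind Aᶜ (ℓ * y + r)

lemma psi_bdd (ℓ m : ℕ) (A : Set ℤ) : Bdd (psi ℓ m A) :=
  (ind_bdd _).sub ((Bdd.sum _ fun (r : ℕ) _ => indc_bdd Aᶜ (fun y => ℓ * y + r)).const_mul _)

lemma psi_sum (A : Set ℕ) (ℓ m : ℕ) (hℓ : 0 < ℓ) (M N : ℕ) (h : (m + ℓ) * M ≤ N) :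
    M - (1 + (m + ℓ : ℝ) / ℓ) * dcount A (N + 1) ≤ ∑ y ∈ Finset.range M, psi ℓ m (AZ A) y := by
  unfold psi
  rw [Finset.sum_sub_distrib, ← Finset.mul_sum]
  have h1 := Csum A ℓ m hℓ M N h
  have h2 : ∑ y ∈ Finset.range M, ∑ r ∈ Finset.range ℓ, ind (AZ A)ᶜ (ℓ * (y : ℤ) + r) ≤ dcount A (N + 1) := by
    have := sum_block ℓ M (fun x : ℕ => ind (AZ A)ᶜ (x : ℤ))
    push_cast at this
    rw [this]
    refine dcount_mono A ?_
    have : ℓ * M ≤ (m + ℓ) * M := Nat.mul_le_mul_right _ (by omega)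
    omega
  have hc : 0 ≤ (m + ℓ : ℝ) / ℓ := by positivity
  have h3 := mul_le_mul_of_nonneg_left h2 hc
  linarith

lemma density_freq (a : ℕ → ℝ) (A : Set ℕ) (ℓ m : ℕ) (hℓ : 0 < ℓ) (δ : ℝ)
    (ha : ∀ N, dcount A (N + 1) ≤ 1 + (N - a N)) (ha2 : ∀ N, a N ≤ N)
    (hδ : (1 + (m + ℓ : ℝ) / ℓ) * (m + ℓ) * δ < 1)
    (hf : ∃ᶠ N : ℕ in atTop, 1 - δ < a N / N) :
    ∃ η : ℝ, 0 < η ∧ ∃ᶠ M : ℕ in atTop, η ≤ (∑ y ∈ Finset.range M, psi ℓ m (AZ A) y) / M := by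
  set T := 1 + (m + ℓ : ℝ) / ℓ with hT
  have hT0 : 0 < T := by positivity
  set θ := 1 - T * (m + ℓ) * δ with hθ
  have hθ0 : 0 < θ := by linarith
  refine ⟨θ / 2, by positivity, ?_⟩
  have htend : Tendsto (fun N : ℕ => N / (m + ℓ)) atTop atTop := Nat.tendsto_div_const_atTop (by omega)
  refine htend.frequently ?_
  obtain ⟨M0, hM0⟩ := exists_nat_gt (2 * (T * (1 + δ * (m + ℓ))) / θ)
  have hev := (htend.eventually (eventually_gt_atTop 0)).and
    ((htend.eventually (eventually_ge_atTop M0)).and (eventually_gt_atTop 0))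
  refine (hf.and_eventually hev).mono ?_
  rintro N ⟨h1, h2, h3, h4⟩
  set M := N / (m + ℓ) with hM
  have hN : (0 : ℝ) < N := by exact_mod_cast h4
  have hMp : (0 : ℝ) < M := by exact_mod_cast h2
  have h5 := psi_sum A ℓ m hℓ M N (Nat.mul_div_le N (m + ℓ))
  rw [lt_div_iff₀ hN] at h1
  have h6 : dcount A (N + 1) ≤ 1 + δ * N := by linarith [ha N]
  have hδ0 : 0 ≤ δ := by
    have := ha2 N
    by_contra hneg
    push Not at hneg
    nlinarith
  have h7 : (N : ℝ) ≤ (m + ℓ) * (M + 1) := by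
    have : N < (m + ℓ) * (N / (m + ℓ) + 1) := Nat.lt_mul_div_succ N (by omega)
    exact_mod_cast this.le
  have h8 : dcount A (N + 1) ≤ 1 + δ * ((m + ℓ) * (M + 1)) := by
    have := mul_le_mul_of_nonneg_left h7 hδ0
    linarith
  have h9 := mul_le_mul_of_nonneg_left h8 hT0.le
  rw [le_div_iff₀ hMp]
  rw [div_lt_iff₀ hθ0] at hM0
  have h10 : (M0 : ℝ) ≤ M := by exact_mod_cast h3
  have h11 := mul_le_mul_of_nonneg_right h10 hθ0.le
  refine le_trans ?_ h5
  have h12 : T * (1 + δ * ((m + ℓ) * (M + 1))) = T * (1 + δ * (m + ℓ)) + (1 - θ) * M := by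
    rw [hθ]; ring
  linarith

lemma final_aux (A : Set ℕ) (ℓ m : ℕ) (hℓ : 0 < ℓ) (hm : 0 < m) {η : ℝ} (hη : 0 < η)
    (hf : ∃ᶠ M : ℕ in atTop, η ≤ (∑ y ∈ Finset.range M, psi ℓ m (AZ A) y) / M) :
    ∃ B : Set ℕ, B.Infinite ∧ ∀ b₁ ∈ B, ∀ b₂ ∈ B, b₁ ≤ b₂ → m * b₁ + ℓ * b₂ ∈ A := by
  obtain ⟨μ, hP, hμ, hpos⟩ := exists_ergodic ⟨ext (psi ℓ m (AZ A)), ext_continuous (psi_bdd _ _ _)⟩ η hη (by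
    refine hf.mono fun M hM => ?_
    unfold avg
    simp only [ContinuousMap.coe_mk, ext_pure]
    exact hM)
  have hsb : Bdd (fun y : ℤ => ∑ r ∈ Finset.range ℓ, ind (AZ A)ᶜ (ℓ * y + r)) :=
    Bdd.sum _ fun r _ => indc_bdd (AZ A)ᶜ (fun y => ℓ * y + r)
  have h1 : 0 < L μ (fun y => ind (Cset ℓ m (AZ A)) y - ((m + ℓ : ℝ) / ℓ) *
      ∑ r ∈ Finset.range ℓ, ind (AZ A)ᶜ (ℓ * y + r)) := hpos
  rw [L_sub (ind_bdd _) (hsb.const_mul _), L_const_mul _ hsb] at h1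
  have h2 : L μ (ind (Cset ℓ m (AZ A))) = μ.real (hat (Cset ℓ m (AZ A))) := by
    unfold L
    simp only [ext_ind]
    rw [integral_indicator (hat_measurable _)]; simp
  rw [h2] at h1
  obtain ⟨b, hb1, hb2⟩ := construct hμ ℓ m hℓ hm (AZ A) (by
    have : (m + ℓ) * Lam μ ℓ (AZ A)ᶜ / ℓ = (m + ℓ : ℝ) / ℓ * Lam μ ℓ (AZ A)ᶜ := by ring
    rw [this]
    unfold Lam
    linarith)
  have hb0 : ∀ n, ((b n).toNat : ℤ) = b n := fun n => Int.toNat_of_nonneg (hb1 n).1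
  have hmono : StrictMono fun n => (b n).toNat := by
    intro i j hij
    have := (hb2 i j hij).1
    have h3 := hb0 i
    have h4 := hb0 j
    show (b i).toNat < (b j).toNat
    omega
  refine ⟨Set.range fun n => (b n).toNat, Set.infinite_range_of_injective hmono.injective, ?_⟩
  rintro _ ⟨i, rfl⟩ _ ⟨j, rfl⟩ hij
  have hij' : i ≤ j := hmono.le_iff_le.1 hij
  rw [← mem_AZ]
  push_cast
  rw [hb0, hb0]
  rcases hij'.eq_or_lt with rfl | hlt
  · have := (hb1 i).2
    rwa [add_mul] at this
  · exact (hb2 i j hlt).2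

end SumsetAux

/-- For `k = m/ℓ` and `A ⊆ ℕ` with upper density `> 1 - 1/(ℓ(k+1)(k+2))`, there exists an
infinite `B ⊆ ℕ` with `{m b₁ + ℓ b₂ : b₁, b₂ ∈ B, b₁ ≤ b₂} ⊆ A`. -/
theorem mB_add_lB_diag_upperDensity_unshifted (ℓ m : ℕ) (hℓ : 0 < ℓ) (hm : 0 < m)
    (k : ℝ) (hk : k = (m : ℝ) / ℓ)
    (A : Set ℕ) (hA : upperDensity A > 1 - 1 / (ℓ * (k + 1) * (k + 2))) :
    ∃ B : Set ℕ, B.Infinite ∧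
      ∀ b₁ ∈ B, ∀ b₂ ∈ B, b₁ ≤ b₂ → m * b₁ + ℓ * b₂ ∈ A := by
  classical
  have hℓ' : (0 : ℝ) < ℓ := by exact_mod_cast hℓ
  have hm' : (0 : ℝ) < m := by exact_mod_cast hm
  have hT : (ℓ : ℝ) * (k + 1) * (k + 2) = (1 + (m + ℓ : ℝ) / ℓ) * (m + ℓ) := by
    rw [hk]; field_simp; ring
  rw [hT] at hA
  have hT0 : 0 < (1 + (m + ℓ : ℝ) / ℓ) * (m + ℓ) := by positivity
  obtain ⟨u, hu1, hu2⟩ := exists_between hA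
  unfold upperDensity at hu2
  have hfr := frequently_lt_of_lt_limsup
    (isCoboundedUnder_le_of_le atTop (x := 0) fun N => by positivity) hu2
  obtain ⟨η, hη, hf⟩ := SumsetAux.density_freq
    (fun N => (((Finset.Icc 1 N).filter (· ∈ A)).card : ℝ)) A ℓ m hℓ (1 - u)
    (SumsetAux.dcount_le A)
    (fun N => by
      have := Finset.card_filter_le (Finset.Icc 1 N) (· ∈ A)
      rw [Nat.card_Icc, Nat.add_sub_cancel] at this
      exact_mod_cast this)
    (by
      have : 1 - u < 1 / ((1 + (m + ℓ : ℝ) / ℓ) * (m + ℓ)) := by linarith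
      rw [lt_div_iff₀ hT0] at this
      linarith)
    (by simpa using hfr)
  exact SumsetAux.final_aux A ℓ m hℓ hm hη hf
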